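/- arXiv:1610.02430 — 2 statements merged into one kernel-verified Lean document; each statement's English description precedes it below -/
import Mathlib

section
/- Let P ⊆ ℝ² be a 2-dimensional lattice polytope with b boundary lattice points, and for each vertex v let σ_v = Cone(P − v) and Eu(v) := 2 − RSV(σ_v). Define δ(P) := 3·Vol(P) − 2b + Σ_{v vertex of P} Eu(v). Then δ(P) ≥ 0, and δ(P) = 0 if and only if P is equivalent, under a map x ↦ Ax + t with A ∈ GL₂(ℤ) and t ∈ ℤ², to conv((0,0), (l,0), (0,1)) for some positive integer l. (By the Matsui–Takeuchi degree formula, δ(P) is the degree formula for the dual of the polarized toric surface X_P and vanishes exactly when X_P is dual defective; hence the only dual defective normal projective toric surfaces are the cones ℙ(1,1,l).) -/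
open MeasureTheory

/-- The standard lattice `ℤ²` inside `ℝ²`. -/
def Lat2 : Set (Fin 2 → ℝ) := {x | ∀ j, ∃ m : ℤ, x j = (m : ℝ)}

/-- `{e₁, e₂}` is a ℤ-basis of the lattice `ℤ² ⊆ ℝ²`, i.e. the two vectors are lattice
vectors generating `ℤ²` as a ℤ-module. -/
def IsZBasis (e₁ e₂ : Fin 2 → ℝ) : Prop :=
  e₁ ∈ Lat2 ∧ e₂ ∈ Lat2 ∧ ∀ x ∈ Lat2, ∃ a b : ℤ, x = a • e₁ + b • e₂

/-- `u` is a primitive lattice vector: its (integer) coordinates have gcd `1`. -/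
def IsPrimitive (u : Fin 2 → ℝ) : Prop :=
  ∃ a b : ℤ, u 0 = (a : ℝ) ∧ u 1 = (b : ℝ) ∧ Int.gcd a b = 1

/-- The cone spanned by two vectors: `Cone(u,v) = ℝ≥0·u + ℝ≥0·v`. -/
def coneTwo (u v : Fin 2 → ℝ) : Set (Fin 2 → ℝ) :=
  {x | ∃ a b : ℝ, 0 ≤ a ∧ 0 ≤ b ∧ x = a • u + b • v}

/-- Matsui–Takeuchi's normalized relative subdiagram volume of a plane cone `σ` at its
apex: twice the Lebesgue measure of `σ ∖ conv((σ ∖ {0}) ∩ ℤ²)`. -/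
noncomputable def RSV (σ : Set (Fin 2 → ℝ)) : ℝ :=
  2 * (volume (σ \ convexHull ℝ ((σ \ {0}) ∩ Lat2))).toReal

/-- The cone of a polytope `P` at a point `v`. -/
def coneAt (P : Set (Fin 2 → ℝ)) (v : Fin 2 → ℝ) : Set (Fin 2 → ℝ) :=
  {x | ∃ t : ℝ, 0 ≤ t ∧ ∃ p ∈ P, x = t • (p - v)}

/-- The Matsui–Takeuchi dual-degree expression for a lattice polygon:
`δ(P) = 3·Vol(P) − 2b + Σ_{v vertex} Eu(v)`, where `Vol(P)` is the normalized area
(twice Lebesgue measure), `b` the number of boundary lattice points, and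
`Eu(v) = 2 − RSV(Cone(P − v))`. -/
noncomputable def deltaP (P : Set (Fin 2 → ℝ)) : ℝ :=
  3 * (2 * (MeasureTheory.volume P).toReal)
    - 2 * ((frontier P ∩ Lat2).ncard : ℝ)
    + ∑ᶠ v ∈ Set.extremePoints ℝ P, (2 - RSV (coneAt P v))

abbrev E2 := Fin 2 → ℝ

/-- the determinant of two plane vectors -/
def dt (u w : E2) : ℝ := u 0 * w 1 - u 1 * w 0

/-- the functional `dt u` -/
noncomputable def dtL (u : E2) : E2 →L[ℝ] ℝ :=
  u 0 • (ContinuousLinearMap.proj 1 : E2 →L[ℝ] ℝ) - u 1 • (ContinuousLinearMap.proj 0 : E2 →L[ℝ] ℝ)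

lemma dtL_apply (u w : E2) : dtL u w = dt u w := by
  simp [dtL, dt]

lemma dtL_ne_zero {u : E2} (hu : u ≠ 0) : dtL u ≠ 0 := by
  intro h
  apply hu
  have h0 := DFunLike.congr_fun h ![1, 0]
  have h1 := DFunLike.congr_fun h ![0, 1]
  simp [dtL_apply, dt] at h0 h1
  ext i; fin_cases i <;> simp [h0, h1]

lemma no_int_max {P : Set E2} {f : E2 →L[ℝ] ℝ} {x : E2} (hx : x ∈ interior P)
    (h : ∀ p ∈ P, f p ≤ f x) : f = 0 := by
  have : IsLocalMax f x := by
    filter_upwards [mem_interior_iff_mem_nhds.1 hx] with p hp using h p hp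
  exact this.hasFDerivAt_eq_zero f.hasFDerivAt

lemma no_int_min {P : Set E2} {f : E2 →L[ℝ] ℝ} {x : E2} (hx : x ∈ interior P)
    (h : ∀ p ∈ P, f x ≤ f p) : f = 0 := by
  have := no_int_max (f := -f) hx (fun p hp => by simpa using h p hp)
  simpa using this

lemma line_null {f : E2 →L[ℝ] ℝ} (hf : f ≠ 0) (c : ℝ) : volume {x : E2 | f x = c} = 0 := by
  have hc : Convex ℝ {x : E2 | f x = c} := by
    intro x hx y hy a b ha hb hab
    simp only [Set.mem_ofPred_eq] at *
    rw [map_add, map_smul, map_smul, hx, hy, ← add_smul, hab, one_smul]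
  have hcl : IsClosed {x : E2 | f x = c} := isClosed_eq f.continuous continuous_const
  have hi : interior {x : E2 | f x = c} = ∅ := by
    by_contra hne
    obtain ⟨x, hx⟩ := Set.nonempty_iff_ne_empty.2 hne
    have hx' := interior_subset hx
    exact hf (no_int_max hx (fun p hp => by
      simp only [Set.mem_ofPred_eq] at hp hx'; rw [hp, hx']))
  have := hc.addHaar_frontier volume
  rwa [hcl.frontier_eq, hi, Set.sdiff_empty] at this

lemma vol_open_tri : volume {x : E2 | 0 < x 0 ∧ 0 < x 1 ∧ x 0 + x 1 < 1} = ENNReal.ofReal (1/2) := by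
  have h1 := volume_regionBetween_eq_integral (μ := (volume : Measure ℝ)) (f := fun _ => (0:ℝ))
    (g := fun x => 1 - x) (s := Set.Ioo 0 1) (by simp)
    ((Continuous.integrableOn_Icc (by fun_prop)).mono_set Set.Ioo_subset_Icc_self)
    measurableSet_Ioo (fun x hx => by linarith [hx.2])
  have h2 : (∫ y in Set.Ioo (0:ℝ) 1, ((fun x => 1 - x) - fun _ => (0:ℝ) : ℝ → ℝ) y) = 1/2 := by
    rw [← MeasureTheory.integral_Ioc_eq_integral_Ioo, ← intervalIntegral.integral_of_le zero_le_one]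
    simp only [Pi.sub_apply, sub_zero]
    rw [intervalIntegral.integral_sub (by simp) (by simp)]
    simp
    norm_num
  rw [h2] at h1
  rw [← h1]
  have hm : MeasurableSet (regionBetween (fun _ => (0:ℝ)) (fun x => 1 - x) (Set.Ioo (0:ℝ) 1)) :=
    measurableSet_regionBetween measurable_const (by fun_prop) measurableSet_Ioo
  have h3 := (volume_preserving_finTwoArrow ℝ).measure_preimage hm.nullMeasurableSet
  rw [← Measure.volume_eq_prod, ← h3]
  congr 1
  ext x
  simp [regionBetween, MeasurableEquiv.finTwoArrow]
  constructor
  · rintro ⟨a, b, c⟩; exact ⟨⟨a, by linarith⟩, b, by linarith⟩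
  · rintro ⟨⟨a, b⟩, c, d⟩; exact ⟨a, c, by linarith⟩

/-- the linear map with columns `u`, `w` -/
noncomputable def colL (u w : E2) : E2 →ₗ[ℝ] E2 := Matrix.toLin' !![u 0, w 0; u 1, w 1]

lemma colL_apply (u w x : E2) : colL u w x = x 0 • u + x 1 • w := by
  ext i
  fin_cases i <;> simp [colL, Matrix.mulVec, dotProduct, Fin.sum_univ_two] <;> ring

lemma colL_det (u w : E2) : LinearMap.det (colL u w) = dt u w := by
  rw [colL, LinearMap.det_toLin', Matrix.det_fin_two_of, dt]; ring

lemma tri_vol {X : Set E2} {p u w : E2}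
    (h1 : ∀ a b : ℝ, 0 < a → 0 < b → a + b < 1 → p + a • u + b • w ∈ X)
    (h2 : ∀ x ∈ X, ∃ a b : ℝ, 0 ≤ a ∧ 0 ≤ b ∧ a + b ≤ 1 ∧ x = p + a • u + b • w) :
    volume X = ENNReal.ofReal (|dt u w| / 2) := by
  set O : Set E2 := {x : E2 | 0 < x 0 ∧ 0 < x 1 ∧ x 0 + x 1 < 1} with hO
  set C : Set E2 := {x : E2 | 0 ≤ x 0 ∧ 0 ≤ x 1 ∧ x 0 + x 1 ≤ 1} with hC
  have hCO : volume C = volume O := by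
    apply le_antisymm
    · have hsub : C ⊆ O ∪ ({x : E2 | (ContinuousLinearMap.proj 0 : E2 →L[ℝ] ℝ) x = 0} ∪
          ({x : E2 | (ContinuousLinearMap.proj 1 : E2 →L[ℝ] ℝ) x = 0} ∪
          {x : E2 | ((ContinuousLinearMap.proj 0 : E2 →L[ℝ] ℝ) + (ContinuousLinearMap.proj 1 : E2 →L[ℝ] ℝ)) x = 1})) := by
        rintro x ⟨ha, hb, hc⟩
        simp only [Set.mem_union, Set.mem_ofPred_eq, hO, ContinuousLinearMap.proj_apply, add_apply]
        rcases ha.eq_or_lt with h | h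
        · right; left; exact h.symm
        rcases hb.eq_or_lt with h' | h'
        · right; right; left; exact h'.symm
        rcases hc.eq_or_lt with h'' | h''
        · right; right; right; exact h''
        · left; exact ⟨h, h', h''⟩
      have n1 : volume {x : E2 | (ContinuousLinearMap.proj 0 : E2 →L[ℝ] ℝ) x = 0} = 0 := by
        apply line_null; intro h; have := DFunLike.congr_fun h ![1, 0]; simp at this
      have n2 : volume {x : E2 | (ContinuousLinearMap.proj 1 : E2 →L[ℝ] ℝ) x = 0} = 0 := by
        apply line_null; intro h; have := DFunLike.congr_fun h ![0, 1]; simp at this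
      have n3 : volume {x : E2 | ((ContinuousLinearMap.proj 0 : E2 →L[ℝ] ℝ) + (ContinuousLinearMap.proj 1 : E2 →L[ℝ] ℝ)) x = 1} = 0 := by
        apply line_null; intro h; have := DFunLike.congr_fun h ![0, 1]; simp at this
      refine (measure_mono hsub).trans ((measure_union_le _ _).trans ?_)
      rw [measure_union_null n1 (measure_union_null n2 n3), add_zero]
    · apply measure_mono
      rintro x ⟨a, b, c⟩; exact ⟨a.le, b.le, c.le⟩
  have key : ∀ Y : Set E2, volume ((fun x => p + x) '' (colL u w '' Y)) = ENNReal.ofReal |dt u w| * volume Y := by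
    intro Y
    rw [← colL_det, ← Measure.addHaar_image_linearMap]
    rw [Set.image_add_left, measure_preimage_add]
  have hval : ENNReal.ofReal |dt u w| * volume O = ENNReal.ofReal (|dt u w| / 2) := by
    rw [hO, vol_open_tri, ← ENNReal.ofReal_mul (abs_nonneg _)]; congr 1; ring
  apply le_antisymm
  · rw [← hval, ← hCO, ← key]
    apply measure_mono
    intro x hx
    obtain ⟨a, b, ha, hb, hab, rfl⟩ := h2 x hx
    refine ⟨_, ⟨![a, b], ⟨by simpa using ha, by simpa using hb, by simpa using hab⟩, rfl⟩, ?_⟩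
    simp [colL_apply, add_assoc]
  · rw [← hval, ← key]
    apply measure_mono
    rintro _ ⟨_, ⟨y, ⟨ha, hb, hab⟩, rfl⟩, rfl⟩
    have := h1 _ _ ha hb hab
    simpa [colL_apply, add_assoc] using this

/-- expansion of a vector in a basis -/
lemma expand {u w : E2} (h : dt u w ≠ 0) (x : E2) :
    x = (dt x w / dt u w) • u + (dt u x / dt u w) • w := by
  have h' : u 0 * w 1 - u 1 * w 0 ≠ 0 := h
  ext i
  fin_cases i <;> simp only [dt, Pi.add_apply, Pi.smul_apply, smul_eq_mul, Fin.zero_eta, Fin.mk_one] <;>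
    rw [div_mul_eq_mul_div, div_mul_eq_mul_div, ← add_div, eq_div_iff h'] <;> ring

lemma mem_tri {a b c x : E2} :
    x ∈ convexHull ℝ ({a, b, c} : Set E2) ↔
      ∃ s t : ℝ, 0 ≤ s ∧ 0 ≤ t ∧ s + t ≤ 1 ∧ x = a + s • (b - a) + t • (c - a) := by
  constructor
  · intro hx
    have hc : Convex ℝ {x : E2 | ∃ s t : ℝ, 0 ≤ s ∧ 0 ≤ t ∧ s + t ≤ 1 ∧ x = a + s • (b - a) + t • (c - a)} := by
      rintro x ⟨s, t, hs, ht, hst, rfl⟩ y ⟨s', t', hs', ht', hst', rfl⟩ α β hα hβ hαβ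
      refine ⟨α * s + β * s', α * t + β * t', by positivity, by positivity, by nlinarith, ?_⟩
      have : β = 1 - α := by linarith
      subst this
      module
    refine convexHull_min ?_ hc hx
    rintro y (rfl | rfl | rfl)
    · exact ⟨0, 0, by simp⟩
    · exact ⟨1, 0, by simp⟩
    · exact ⟨0, 1, by simp⟩
  · rintro ⟨s, t, hs, ht, hst, rfl⟩
    have hcv := convex_convexHull ℝ ({a, b, c} : Set E2)
    have ha : a ∈ convexHull ℝ ({a, b, c} : Set E2) := subset_convexHull ℝ _ (by simp)
    have hb : b ∈ convexHull ℝ ({a, b, c} : Set E2) := subset_convexHull ℝ _ (by simp)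
    have hc : c ∈ convexHull ℝ ({a, b, c} : Set E2) := subset_convexHull ℝ _ (by simp)
    have := hcv.sum_mem (t := Finset.univ) (w := ![1 - s - t, s, t]) (z := ![a, b, c])
      (by intro i _; fin_cases i <;> simp <;> linarith)
      (by simp [Fin.sum_univ_three]; ring)
      (by intro i _; fin_cases i <;> simp [ha, hb, hc])
    convert this using 1
    simp [Fin.sum_univ_three]
    module

lemma tri_volume (a b c : E2) :
    volume (convexHull ℝ ({a, b, c} : Set E2)) = ENNReal.ofReal (|dt (b - a) (c - a)| / 2) := by
  apply tri_vol (p := a)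
  · intro s t hs ht hst
    exact mem_tri.2 ⟨s, t, hs.le, ht.le, hst.le, rfl⟩
  · intro x hx; exact mem_tri.1 hx

/-- points with positive barycentric coordinates are interior -/
lemma tri_interior {P : Set E2} (hP : Convex ℝ P) {a b c : E2} (ha : a ∈ P) (hb : b ∈ P) (hc : c ∈ P)
    (hD : dt (b - a) (c - a) ≠ 0) {s t : ℝ} (hs : 0 < s) (ht : 0 < t) (hst : s + t < 1) :
    a + s • (b - a) + t • (c - a) ∈ interior P := by
  set D := dt (b - a) (c - a) with hDdef
  set U : Set E2 := {x | 0 < dt (x - a) (c - a) / D ∧ 0 < dt (b - a) (x - a) / D ∧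
    dt (x - a) (c - a) / D + dt (b - a) (x - a) / D < 1} with hU
  have hUo : IsOpen U := by
    have c1 : Continuous fun x : E2 => dt (x - a) (c - a) / D := by
      unfold dt; simp only [Pi.sub_apply]; fun_prop
    have c2 : Continuous fun x : E2 => dt (b - a) (x - a) / D := by
      unfold dt; simp only [Pi.sub_apply]; fun_prop
    exact (isOpen_lt continuous_const c1).inter
      ((isOpen_lt continuous_const c2).inter (isOpen_lt (c1.add c2) continuous_const))
  have hsub : U ⊆ P := by
    rintro x ⟨h1, h2, h3⟩
    have hx : x ∈ convexHull ℝ ({a, b, c} : Set E2) := by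
      refine mem_tri.2 ⟨_, _, h1.le, h2.le, h3.le, ?_⟩
      have := expand hD (x - a)
      rw [add_assoc, ← hDdef] at *
      rw [← this]; abel
    refine convexHull_min ?_ hP hx
    rintro y (rfl | rfl | rfl) <;> assumption
  refine interior_maximal hsub hUo ?_
  have e1 : dt (a + s • (b - a) + t • (c - a) - a) (c - a) = s * D := by
    simp only [hDdef, dt, Pi.sub_apply, Pi.add_apply, Pi.smul_apply, smul_eq_mul]; ring
  have e2 : dt (b - a) (a + s • (b - a) + t • (c - a) - a) = t * D := by
    simp only [hDdef, dt, Pi.sub_apply, Pi.add_apply, Pi.smul_apply, smul_eq_mul]; ring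
  simp only [hU, Set.mem_ofPred_eq, e1, e2]
  rw [mul_div_cancel_right₀ _ hD, mul_div_cancel_right₀ _ hD]
  exact ⟨hs, ht, hst⟩

/-- a set whose hull has interior contains a nondegenerate triple -/
lemma exists_triple {S : Set E2} (h : (interior (convexHull ℝ S)).Nonempty) :
    ∃ a ∈ S, ∃ b ∈ S, ∃ c ∈ S, dt (b - a) (c - a) ≠ 0 := by
  by_contra! hcon
  obtain ⟨x, hx⟩ := h
  have hne : S.Nonempty := by
    rw [Set.nonempty_iff_ne_empty]; rintro rfl; simp at hx
  obtain ⟨a, ha⟩ := hne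
  -- there is a nonzero functional constant on S
  obtain ⟨f, hf, c, hfc⟩ : ∃ f : E2 →L[ℝ] ℝ, f ≠ 0 ∧ ∃ c, ∀ s ∈ S, f s = c := by
    by_cases hb : ∃ b ∈ S, b ≠ a
    · obtain ⟨b, hb, hba⟩ := hb
      refine ⟨dtL (b - a), dtL_ne_zero (sub_ne_zero.2 hba), dtL (b - a) a, fun s hs => ?_⟩
      have := hcon a ha b hb s hs
      rw [← dtL_apply, map_sub] at this
      linarith
    · push Not at hb
      refine ⟨dtL ![1, 0], dtL_ne_zero (fun h => by simpa using congr_fun h 0), dtL ![1, 0] a, fun s hs => ?_⟩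
      rw [hb s hs]
  have hsub : convexHull ℝ S ⊆ {x | f x = c} := by
    refine convexHull_min hfc ?_
    intro x hx y hy a b ha hb hab
    simp only [Set.mem_ofPred_eq] at *
    rw [map_add, map_smul, map_smul, hx, hy, ← add_smul, hab, one_smul]
  apply hf
  refine no_int_max hx (fun p hp => ?_)
  rw [hsub hp, hsub (interior_subset hx)]

lemma int_count (u0 u1 w0 w1 D : ℤ) (hDd : D = u0 * w1 - u1 * w0) (hD : 0 < D)
    (h : ∀ x y : ℤ, 0 ≤ x * w1 - y * w0 → 0 ≤ u0 * y - u1 * x →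
      (x * w1 - y * w0) + (u0 * y - u1 * x) ≤ D →
      (x = 0 ∧ y = 0) ∨ (x = u0 ∧ y = u1) ∨ (x = w0 ∧ y = w1) ∨
      (0 < x * w1 - y * w0 ∧ 0 < u0 * y - u1 * x ∧ (x * w1 - y * w0) + (u0 * y - u1 * x) < D)) :
    D = 2 * ({z : ℤ × ℤ | 0 < z.1 * w1 - z.2 * w0 ∧ 0 < u0 * z.2 - u1 * z.1 ∧
      (z.1 * w1 - z.2 * w0) + (u0 * z.2 - u1 * z.1) < D}.ncard : ℤ) + 1 := by
  -- coprimality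
  have hg : IsCoprime u0 u1 := by
    rw [Int.isCoprime_iff_gcd_eq_one]
    obtain ⟨a, ha⟩ := Int.gcd_dvd_left u0 u1
    obtain ⟨b, hb⟩ := Int.gcd_dvd_right u0 u1
    set g : ℕ := Int.gcd u0 u1 with hgdef
    have hgD : (g : ℤ) * (a * w1 - b * w0) = D := by rw [hDd]; linear_combination -w1 * ha + w0 * hb
    have hg0 : (0 : ℤ) < g := by
      rcases Nat.eq_zero_or_pos g with h0 | h0
      · rw [h0] at hgD; simp at hgD; omega
      · exact_mod_cast h0
    have hα : 0 < a * w1 - b * w0 := by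
      by_contra hc; push Not at hc; nlinarith
    have hβ : u0 * b - u1 * a = 0 := by
      rw [ha, hb]; ring
    have hle : a * w1 - b * w0 ≤ D := by nlinarith
    rcases h a b hα.le hβ.ge (by omega) with h1 | h1 | h1 | h1
    · rw [h1.1, h1.2] at hα; simp at hα
    · have : (g : ℤ) * D = D := by
        rw [h1.1, h1.2, ← hDd] at hgD; exact hgD
      have : (g : ℤ) = 1 := by nlinarith
      exact_mod_cast this
    · rw [h1.1, h1.2] at hα; ring_nf at hα; omega
    · omega
  obtain ⟨p, q, hpq⟩ := hg
  set I : Set (ℤ × ℤ) := {z : ℤ × ℤ | 0 < z.1 * w1 - z.2 * w0 ∧ 0 < u0 * z.2 - u1 * z.1 ∧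
      (z.1 * w1 - z.2 * w0) + (u0 * z.2 - u1 * z.1) < D} with hI
  set Box : Set (ℤ × ℤ) := {z : ℤ × ℤ | 0 ≤ z.1 * w1 - z.2 * w0 ∧ z.1 * w1 - z.2 * w0 < D ∧
    0 ≤ u0 * z.2 - u1 * z.1 ∧ u0 * z.2 - u1 * z.1 < D} with hBox
  have hinj : Set.InjOn (fun z : ℤ × ℤ => u0 * z.2 - u1 * z.1) Box := by
    rintro ⟨x, y⟩ ⟨h1, h2, -, -⟩ ⟨x', y'⟩ ⟨h1', h2', -, -⟩ he
    simp only at he h1 h2 h1' h2'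
    -- difference is k * u
    set k := p * (x - x') + q * (y - y') with hk
    have hx : x - x' = k * u0 := by
      rw [hk]; linear_combination (-(x - x')) * hpq - q * he
    have hy : y - y' = k * u1 := by
      rw [hk]; linear_combination (-(y - y')) * hpq + p * he
    have hkD : (x * w1 - y * w0) - (x' * w1 - y' * w0) = k * D := by
      rw [hDd]; linear_combination w1 * hx - w0 * hy
    have hk0 : k = 0 := by
      have : k < 1 := by by_contra hc; push Not at hc; nlinarith
      have : -1 < k := by by_contra hc; push Not at hc; nlinarith
      omega
    rw [hk0] at hx hy
    ext <;> simp <;> omega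
  have himg : (fun z : ℤ × ℤ => u0 * z.2 - u1 * z.1) '' Box = Set.Ico 0 D := by
    ext y
    constructor
    · rintro ⟨z, ⟨-, -, h3, h4⟩, rfl⟩; exact ⟨h3, h4⟩
    · rintro ⟨h0, h1⟩
      -- base solution
      set α := (-q * y) * w1 - (p * y) * w0 with hα
      refine ⟨(-q * y - (α / D) * u0, p * y - (α / D) * u1), ?_, ?_⟩
      · have e1 : (-q * y - (α / D) * u0) * w1 - (p * y - (α / D) * u1) * w0 = α % D := by
          have := Int.emod_add_mul_ediv α D
          rw [hDd] at this ⊢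
          rw [← hDd] at this ⊢
          linear_combination (-1 : ℤ) * this + (α / D) * hDd + hα
        have e2 : u0 * (p * y - (α / D) * u1) - u1 * (-q * y - (α / D) * u0) = y := by
          linear_combination y * hpq
        refine ⟨?_, ?_, ?_, ?_⟩ <;> simp only [e1, e2]
        · exact Int.emod_nonneg _ hD.ne'
        · exact Int.emod_lt_of_pos _ hD
        · exact h0
        · exact h1
      · simp only; linear_combination y * hpq
  have hcard : Box.ncard = D.toNat := by
    rw [← hinj.ncard_image, himg, ← Finset.coe_Ico, Set.ncard_coe_finset, Int.card_Ico, sub_zero]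
  have hfin : Box.Finite := by
    refine Set.Finite.of_finite_image ?_ hinj
    rw [himg]; exact Set.finite_Ico _ _
  set I' : Set (ℤ × ℤ) := (fun z : ℤ × ℤ => (u0 + w0 - z.1, u1 + w1 - z.2)) '' I with hI'
  have hI'card : I'.ncard = I.ncard := by
    apply Set.ncard_image_of_injective
    rintro ⟨a, b⟩ ⟨c, d⟩ h
    simp only [Prod.mk.injEq] at h
    ext <;> simp <;> omega
  have hmemI' : ∀ z : ℤ × ℤ, z ∈ I' ↔ z.1 * w1 - z.2 * w0 < D ∧ u0 * z.2 - u1 * z.1 < D ∧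
      D < (z.1 * w1 - z.2 * w0) + (u0 * z.2 - u1 * z.1) := by
    intro z
    constructor
    · rintro ⟨y, ⟨h1, h2, h3⟩, rfl⟩
      simp only
      refine ⟨?_, ?_, ?_⟩ <;> nlinarith
    · rintro ⟨h1, h2, h3⟩
      refine ⟨(u0 + w0 - z.1, u1 + w1 - z.2), ⟨?_, ?_, ?_⟩, ?_⟩
      · simp only; nlinarith
      · simp only; nlinarith
      · simp only; nlinarith
      · ext <;> simp
  have hdec : Box = insert (0, 0) (I ∪ I') := by
    ext z
    rw [Set.mem_insert_iff, Set.mem_union, hmemI']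
    constructor
    · rintro ⟨h1, h2, h3, h4⟩
      by_cases hs : (z.1 * w1 - z.2 * w0) + (u0 * z.2 - u1 * z.1) ≤ D
      · rcases h z.1 z.2 h1 h3 hs with h5 | h5 | h5 | h5
        · left; ext <;> simp [h5]
        · rw [h5.1, h5.2] at h2; omega
        · rw [h5.1, h5.2] at h4; omega
        · right; left; exact h5
      · push Not at hs; right; right; exact ⟨h2, h4, hs⟩
    · rintro (rfl | ⟨h1, h2, h3⟩ | ⟨h1, h2, h3⟩)
      · simp only [hBox, Set.mem_ofPred_eq]; simp [hD]
      · refine ⟨h1.le, ?_, h2.le, ?_⟩ <;> omega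
      · refine ⟨?_, h1, ?_, h2⟩ <;> omega
  have hdisj : Disjoint I I' := by
    rw [Set.disjoint_left]
    intro z h1 h2
    rw [hmemI'] at h2
    have := h1.2.2
    omega
  have h0 : ((0, 0) : ℤ × ℤ) ∉ I ∪ I' := by
    rw [Set.mem_union, hmemI']
    simp [hI]
    intro _; omega
  have hfIU : (I ∪ I').Finite := hfin.subset (by rw [hdec]; exact Set.subset_insert _ _)
  have hfI : I.Finite := hfIU.subset Set.subset_union_left
  have hfI' : I'.Finite := hfIU.subset Set.subset_union_right
  have := hcard
  rw [hdec, Set.ncard_insert_of_notMem h0 hfIU, Set.ncard_union_eq hdisj hfI hfI', hI'card] at this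
  omega

/-- lattice polygons -/
structure LP (P : Set E2) : Prop where
  cpt : IsCompact P
  cvx : Convex ℝ P
  hull : P ⊆ convexHull ℝ (P ∩ Lat2)
  int : (interior P).Nonempty

/-- the embedding of the integer lattice -/
def iot (z : ℤ × ℤ) : E2 := ![(z.1 : ℝ), (z.2 : ℝ)]

lemma iot_inj : Function.Injective iot := by
  rintro ⟨a, b⟩ ⟨c, d⟩ h
  have h0 := congr_fun h 0
  have h1 := congr_fun h 1
  simp [iot] at h0 h1
  rw [h0, h1]

lemma mem_lat_iff {x : E2} : x ∈ Lat2 ↔ ∃ z, iot z = x := by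
  constructor
  · intro h
    obtain ⟨a, ha⟩ := h 0
    obtain ⟨b, hb⟩ := h 1
    refine ⟨(a, b), ?_⟩
    ext i; fin_cases i <;> simp [iot, ha, hb]
  · rintro ⟨z, rfl⟩ i
    fin_cases i
    · exact ⟨z.1, by simp [iot]⟩
    · exact ⟨z.2, by simp [iot]⟩

lemma lat_add {x y : E2} (hx : x ∈ Lat2) (hy : y ∈ Lat2) : x + y ∈ Lat2 := by
  intro j
  obtain ⟨a, ha⟩ := hx j
  obtain ⟨b, hb⟩ := hy j
  exact ⟨a + b, by simp [ha, hb]⟩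

lemma lat_neg {x : E2} (hx : x ∈ Lat2) : -x ∈ Lat2 := by
  intro j
  obtain ⟨a, ha⟩ := hx j
  exact ⟨-a, by simp [ha]⟩

lemma lat_sub {x y : E2} (hx : x ∈ Lat2) (hy : y ∈ Lat2) : x - y ∈ Lat2 := by
  rw [sub_eq_add_neg]; exact lat_add hx (lat_neg hy)

lemma lat_zsmul {x : E2} (hx : x ∈ Lat2) (n : ℤ) : (n : ℝ) • x ∈ Lat2 := by
  intro j
  obtain ⟨a, ha⟩ := hx j
  exact ⟨n * a, by simp [ha]⟩

lemma lat_finite {P : Set E2} (hP : IsCompact P) : (P ∩ Lat2).Finite := by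
  obtain ⟨R, hR⟩ := hP.isBounded.subset_closedBall 0
  obtain ⟨n, hn⟩ := exists_nat_ge R
  refine ((Set.finite_Icc (-(n:ℤ)) n).prod (Set.finite_Icc (-(n:ℤ)) n)).image iot |>.subset ?_
  rintro x ⟨hxP, hxL⟩
  obtain ⟨z, rfl⟩ := mem_lat_iff.1 hxL
  refine ⟨z, ?_, rfl⟩
  have h := hR hxP
  rw [mem_closedBall_zero_iff] at h
  have h0 := abs_le.1 ((norm_le_pi_norm (iot z) 0).trans (h.trans hn))
  have h1 := abs_le.1 ((norm_le_pi_norm (iot z) 1).trans (h.trans hn))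
  simp [iot] at h0 h1
  refine ⟨⟨?_, ?_⟩, ⟨?_, ?_⟩⟩
  · exact_mod_cast h0.1
  · exact_mod_cast h0.2
  · exact_mod_cast h1.1
  · exact_mod_cast h1.2

lemma mem_tri' {a b c x : E2} (hD : 0 < dt (b - a) (c - a)) :
    x ∈ convexHull ℝ ({a, b, c} : Set E2) ↔
      0 ≤ dt (x - a) (c - a) ∧ 0 ≤ dt (b - a) (x - a) ∧
      dt (x - a) (c - a) + dt (b - a) (x - a) ≤ dt (b - a) (c - a) := by
  rw [mem_tri]
  constructor
  · rintro ⟨s, t, hs, ht, hst, rfl⟩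
    have e1 : dt (a + s • (b - a) + t • (c - a) - a) (c - a) = s * dt (b - a) (c - a) := by
      simp only [dt, Pi.sub_apply, Pi.add_apply, Pi.smul_apply, smul_eq_mul]; ring
    have e2 : dt (b - a) (a + s • (b - a) + t • (c - a) - a) = t * dt (b - a) (c - a) := by
      simp only [dt, Pi.sub_apply, Pi.add_apply, Pi.smul_apply, smul_eq_mul]; ring
    rw [e1, e2]
    refine ⟨by positivity, by positivity, by nlinarith⟩
  · rintro ⟨h1, h2, h3⟩
    refine ⟨_, _, div_nonneg h1 hD.le, div_nonneg h2 hD.le, ?_, ?_⟩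
    · rw [← add_div, div_le_one hD]; exact h3
    · rw [add_assoc, ← expand hD.ne']; abel

lemma tri_int_pos {a b c x : E2} (hD : 0 < dt (b - a) (c - a))
    (hx : x ∈ interior (convexHull ℝ ({a, b, c} : Set E2))) :
      0 < dt (x - a) (c - a) ∧ 0 < dt (b - a) (x - a) ∧
      dt (x - a) (c - a) + dt (b - a) (x - a) < dt (b - a) (c - a) := by
  have hx' := (mem_tri' hD).1 (interior_subset hx)
  have hba : b - a ≠ 0 := by intro h; rw [h] at hD; simp [dt] at hD
  have hca : c - a ≠ 0 := by intro h; rw [h] at hD; simp [dt] at hD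
  have hbc : b - c ≠ 0 := by
    intro h; rw [sub_eq_zero.1 h] at hD; simp only [dt] at hD; ring_nf at hD; exact lt_irrefl _ hD
  refine ⟨lt_of_le_of_ne hx'.1 ?_, lt_of_le_of_ne hx'.2.1 ?_, lt_of_le_of_ne hx'.2.2 ?_⟩
  · intro h
    refine dtL_ne_zero hca (no_int_max hx fun p hp => ?_)
    have := ((mem_tri' hD).1 hp).1
    simp only [dtL_apply, dt, Pi.sub_apply] at *
    linarith
  · intro h
    refine dtL_ne_zero hba (no_int_min hx fun p hp => ?_)
    have := ((mem_tri' hD).1 hp).2.1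
    simp only [dtL_apply, dt, Pi.sub_apply] at *
    linarith
  · intro h
    refine dtL_ne_zero hbc (no_int_max hx fun p hp => ?_)
    have := ((mem_tri' hD).1 hp).2.2
    simp only [dtL_apply, dt, Pi.sub_apply] at *
    linarith

/-- Pick's formula for triangles with no boundary lattice points besides the vertices -/
lemma pick_base {P : Set E2} {a b c : E2} (hPe : P = convexHull ℝ ({a, b, c} : Set E2))
    (ha : a ∈ Lat2) (hb : b ∈ Lat2) (hc : c ∈ Lat2) (hD : 0 < dt (b - a) (c - a))
    (hB : ∀ x ∈ P ∩ Lat2, x ∉ interior P → x = a ∨ x = b ∨ x = c) :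
    2 * (volume P).toReal = (P ∩ Lat2).ncard + (interior P ∩ Lat2).ncard - 2 := by
  obtain ⟨⟨u0, u1⟩, hu⟩ := mem_lat_iff.1 (lat_sub hb ha)
  obtain ⟨⟨w0, w1⟩, hw⟩ := mem_lat_iff.1 (lat_sub hc ha)
  set D : ℤ := u0 * w1 - u1 * w0 with hDd
  have hDD : dt (b - a) (c - a) = D := by
    rw [← hu, ← hw, hDd]; simp [dt, iot]
  have hα : ∀ z : ℤ × ℤ, dt (a + iot z - a) (c - a) = ((z.1 * w1 - z.2 * w0 : ℤ) : ℝ) := by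
    intro z; rw [← hw, add_sub_cancel_left]; simp [dt, iot]
  have hβ : ∀ z : ℤ × ℤ, dt (b - a) (a + iot z - a) = ((u0 * z.2 - u1 * z.1 : ℤ) : ℝ) := by
    intro z; rw [← hu, add_sub_cancel_left]; simp [dt, iot]
  have hD' : 0 < D := by rw [hDD] at hD; exact_mod_cast hD
  have hmem : ∀ z : ℤ × ℤ, a + iot z ∈ P ↔ 0 ≤ z.1 * w1 - z.2 * w0 ∧ 0 ≤ u0 * z.2 - u1 * z.1 ∧
      (z.1 * w1 - z.2 * w0) + (u0 * z.2 - u1 * z.1) ≤ D := by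
    intro z
    rw [hPe, mem_tri' hD, hα, hβ, hDD]
    norm_cast
  have h_intr : ∀ z : ℤ × ℤ, a + iot z ∈ interior P ↔ 0 < z.1 * w1 - z.2 * w0 ∧ 0 < u0 * z.2 - u1 * z.1 ∧
      (z.1 * w1 - z.2 * w0) + (u0 * z.2 - u1 * z.1) < D := by
    intro z
    constructor
    · intro h
      rw [hPe] at h
      have := tri_int_pos hD h
      rw [hα, hβ, hDD] at this
      exact_mod_cast this
    · rintro ⟨h1, h2, h3⟩
      have hP : Convex ℝ P := by rw [hPe]; exact convex_convexHull ℝ _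
      have hsub : ({a, b, c} : Set E2) ⊆ P := by rw [hPe]; exact subset_convexHull ℝ _
      have e := expand hD.ne' (a + iot z - a)
      have := tri_interior hP (hsub (by simp) : a ∈ P) (hsub (by simp) : b ∈ P) (hsub (by simp) : c ∈ P) hD.ne'
        (s := dt (a + iot z - a) (c - a) / dt (b - a) (c - a))
        (t := dt (b - a) (a + iot z - a) / dt (b - a) (c - a))
        (div_pos (by rw [hα]; exact_mod_cast h1) hD) (div_pos (by rw [hβ]; exact_mod_cast h2) hD)
        (by rw [← add_div, div_lt_one hD, hα, hβ, hDD]; exact_mod_cast h3)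
      rw [add_assoc, ← e] at this
      convert this using 1
      abel
  have hcount := int_count u0 u1 w0 w1 D hDd hD' (by
    intro x y h1 h2 h3
    have hP := (hmem (x, y)).2 ⟨h1, h2, h3⟩
    have hL : a + iot (x, y) ∈ Lat2 := lat_add ha (mem_lat_iff.2 ⟨_, rfl⟩)
    by_cases hi : a + iot (x, y) ∈ interior P
    · right; right; right; exact (h_intr (x, y)).1 hi
    · rcases hB _ ⟨hP, hL⟩ hi with h | h | h
      · left
        have h' : iot (x, y) = iot (0, 0) := by
          have : iot (x, y) = 0 := by simpa using h
          rw [this]; ext i; fin_cases i <;> simp [iot]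
        have := iot_inj h'
        simpa using this
      · right; left
        have h' : iot (x, y) = iot (u0, u1) := by rw [hu, ← h]; abel
        simpa using iot_inj h'
      · right; right; left
        have h' : iot (x, y) = iot (w0, w1) := by rw [hw, ← h]; abel
        simpa using iot_inj h')
  set I : Set (ℤ × ℤ) := {z : ℤ × ℤ | 0 < z.1 * w1 - z.2 * w0 ∧ 0 < u0 * z.2 - u1 * z.1 ∧
      (z.1 * w1 - z.2 * w0) + (u0 * z.2 - u1 * z.1) < D} with hI
  have hIimg : interior P ∩ Lat2 = (fun z => a + iot z) '' I := by
    ext x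
    constructor
    · rintro ⟨hx, hxL⟩
      obtain ⟨z, hz⟩ := mem_lat_iff.1 (lat_sub hxL ha)
      have hxz : a + iot z = x := by rw [hz]; abel
      refine ⟨z, ?_, hxz⟩
      rw [← hxz] at hx
      exact (h_intr z).1 hx
    · rintro ⟨z, hz, rfl⟩
      exact ⟨(h_intr z).2 hz, lat_add ha (mem_lat_iff.2 ⟨_, rfl⟩)⟩
  have hIc : (interior P ∩ Lat2).ncard = I.ncard := by
    rw [hIimg]
    apply Set.ncard_image_of_injective
    intro z z' h
    exact iot_inj (add_left_cancel h)
  have hcpt : IsCompact P := by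
    rw [hPe]; exact Set.Finite.isCompact_convexHull ℝ (by simp)
  have hfin : (interior P ∩ Lat2).Finite :=
    (lat_finite hcpt).subset (Set.inter_subset_inter_left _ interior_subset)
  have hba : b ≠ a := by rintro rfl; simp [dt] at hD
  have hca : c ≠ a := by rintro rfl; simp [dt] at hD
  have hbc : b ≠ c := by rintro rfl; simp only [dt] at hD; ring_nf at hD; exact lt_irrefl _ hD
  have hnot : ∀ x ∈ ({a, b, c} : Set E2), x ∉ interior P ∩ Lat2 := by
    rintro x hx ⟨hx', -⟩
    rw [hPe] at hx'
    have := tri_int_pos hD hx'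
    rcases hx with rfl | rfl | rfl
    · simp [dt] at this
    · linarith [this.2.1, this.2.2]
    · linarith [this.2.1, this.2.2, this.1]
  have hS : P ∩ Lat2 = {a, b, c} ∪ (interior P ∩ Lat2) := by
    ext x
    constructor
    · intro hx
      by_cases hi : x ∈ interior P
      · right; exact ⟨hi, hx.2⟩
      · left; exact hB x hx hi
    · rintro (hx | hx)
      · refine ⟨by rw [hPe]; exact subset_convexHull ℝ _ hx, ?_⟩
        rcases hx with rfl | rfl | rfl <;> assumption
      · exact ⟨interior_subset hx.1, hx.2⟩
  have h3 : ({a, b, c} : Set E2).ncard = 3 := Set.ncard_eq_three.2 ⟨a, b, c, hba.symm, hca.symm, hbc, rfl⟩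
  have hSc : (P ∩ Lat2).ncard = 3 + (interior P ∩ Lat2).ncard := by
    rw [hS, Set.ncard_union_eq (Set.disjoint_left.2 hnot) (by simp) hfin, h3]
  rw [hSc, hIc]
  have hv : 2 * (volume P).toReal = D := by
    rw [hPe, tri_volume, ENNReal.toReal_ofReal (by positivity), abs_of_pos hD, hDD]; ring
  rw [hv]
  have : (D : ℝ) = 2 * (I.ncard : ℝ) + 1 := by exact_mod_cast hcount
  rw [this]; push_cast; ring

lemma support_fn {P : Set E2} (hc : Convex ℝ P) (hi : (interior P).Nonempty) {m : E2}
    (hm : m ∉ interior P) : ∃ f : E2 →L[ℝ] ℝ, f ≠ 0 ∧ ∀ p ∈ P, f p ≤ f m := by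
  obtain ⟨f, hf⟩ := geometric_hahn_banach_open_point hc.interior isOpen_interior hm
  refine ⟨f, ?_, ?_⟩
  · rintro rfl
    obtain ⟨q, hq⟩ := hi
    simpa using hf q hq
  · intro p hp
    have h1 : p ∈ closure (interior P) := by
      rw [hc.closure_interior_eq_closure_of_nonempty_interior hi]; exact subset_closure hp
    have h2 : closure (interior P) ⊆ {x | f x ≤ f m} :=
      closure_minimal (fun x hx => (hf x hx).le) (isClosed_le f.continuous continuous_const)
    exact h2 h1

/-- If the open segment `ab` misses the interior, then `P` lies on the side of `c`. -/
lemma side {P : Set E2} (hc : Convex ℝ P) (hi : (interior P).Nonempty) {a b c : E2}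
    (ha : a ∈ P) (hb : b ∈ P) (hcP : c ∈ P) (hD : dt (b - a) (c - a) ≠ 0)
    (hm : (1/2 : ℝ) • a + (1/2 : ℝ) • b ∉ interior P) {x : E2} (hx : x ∈ P) :
    0 ≤ dt (b - a) (x - a) / dt (b - a) (c - a) := by
  obtain ⟨f, hf0, hf⟩ := support_fn hc hi hm
  have h1 := hf a ha
  have h2 := hf b hb
  have h3 := hf c hcP
  have h4 := hf x hx
  rw [map_add, map_smul, map_smul, smul_eq_mul, smul_eq_mul] at h1 h2 h3 h4
  have hab : f a = f b := by linarith
  have hca : f c ≤ f a := by linarith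
  have hxa : f x ≤ f a := by linarith
  have hfx : ∀ y : E2, f y - f a = dt (b - a) (y - a) / dt (b - a) (c - a) * (f c - f a) := by
    intro y
    have e := congrArg f (expand hD (y - a))
    simp only [map_add, map_smul, map_sub, smul_eq_mul] at e
    rw [e, hab]; ring
  have hne : f c ≠ f a := by
    intro h
    apply hf0
    ext y
    have := hfx (y + a)
    rw [h, sub_self, mul_zero, map_add] at this
    simpa using this
  have hlt : f c - f a < 0 := by
    have := lt_of_le_of_ne hca hne; linarith
  have := hfx x
  by_contra hneg
  push Not at hneg
  nlinarith [mul_pos_of_neg_of_neg hneg hlt]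

lemma LP.finite {P : Set E2} (h : LP P) : (P ∩ Lat2).Finite := lat_finite h.cpt

lemma LP.eq {P : Set E2} (h : LP P) : convexHull ℝ (P ∩ Lat2) = P :=
  Set.Subset.antisymm (convexHull_min Set.inter_subset_left h.cvx) h.hull

lemma LP.ext_sub {P : Set E2} (h : LP P) : Set.extremePoints ℝ P ⊆ P ∩ Lat2 := by
  have := extremePoints_convexHull_subset (𝕜 := ℝ) (A := P ∩ Lat2)
  rwa [h.eq] at this

lemma LP.hull_ext {P : Set E2} (h : LP P) : convexHull ℝ (Set.extremePoints ℝ P) = P := by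
  have h1 := closure_convexHull_extremePoints h.cpt h.cvx
  have hf : (Set.extremePoints ℝ P).Finite := h.finite.subset h.ext_sub
  rwa [(Set.Finite.isCompact_convexHull ℝ hf).isClosed.closure_eq] at h1

lemma ext_not_int {P : Set E2} {v : E2} (hv : v ∈ Set.extremePoints ℝ P) : v ∉ interior P := by
  intro hi
  -- v ± small vector
  have hcont : Continuous fun t : ℝ => v + t • (![1, 0] : E2) := by fun_prop
  have h0 : (fun t : ℝ => v + t • (![1, 0] : E2)) ⁻¹' interior P ∈ nhds (0 : ℝ) := by
    apply hcont.continuousAt.preimage_mem_nhds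
    simpa using isOpen_interior.mem_nhds hi
  obtain ⟨ε, hε, hball⟩ := Metric.mem_nhds_iff.1 h0
  have hp : v + (ε/2) • (![1, 0] : E2) ∈ P := interior_subset (hball (by simp [abs_of_pos hε]; linarith))
  have hq : v + (-(ε/2)) • (![1, 0] : E2) ∈ P := interior_subset (hball (by simp [abs_of_pos hε]; linarith))
  have := hv.2 hp hq ⟨1/2, 1/2, by norm_num, by norm_num, by norm_num, by module⟩
  have h1 := congr_fun this 0
  simp at h1
  linarith

lemma LP.ext_triple {P : Set E2} (h : LP P) : ∃ a ∈ Set.extremePoints ℝ P,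
    ∃ b ∈ Set.extremePoints ℝ P, ∃ c ∈ Set.extremePoints ℝ P, dt (b - a) (c - a) ≠ 0 := by
  apply exists_triple
  rw [h.hull_ext]; exact h.int

lemma dt_rot (a b c : E2) : dt (c - b) (a - b) = dt (b - a) (c - a) := by
  simp [dt]; ring

lemma dt_swap (a b c : E2) : dt (c - a) (b - a) = - dt (b - a) (c - a) := by
  simp [dt]; ring

lemma div_nonneg_iff_of_pos {a b : ℝ} (hb : 0 < b) : 0 ≤ a / b ↔ 0 ≤ a := by
  rw [le_div_iff₀ hb, zero_mul]

/-- no chord through the interior: then `P` is a triangle without extra boundary lattice points -/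
lemma no_chord {P : Set E2} (h : LP P)
    (hno : ∀ x ∈ P ∩ Lat2, ∀ y ∈ P ∩ Lat2, x ∉ interior P → y ∉ interior P →
      (1/2 : ℝ) • x + (1/2 : ℝ) • y ∉ interior P) :
    2 * (volume P).toReal = (P ∩ Lat2).ncard + (interior P ∩ Lat2).ncard - 2 := by
  obtain ⟨a, ha, b, hb, c, hc, hD⟩ : ∃ a ∈ Set.extremePoints ℝ P,
    ∃ b ∈ Set.extremePoints ℝ P, ∃ c ∈ Set.extremePoints ℝ P, 0 < dt (b - a) (c - a) := by
    obtain ⟨a, ha, b, hb, c, hc, hD⟩ := h.ext_triple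
    rcases lt_or_gt_of_ne hD with h' | h'
    · refine ⟨a, ha, c, hc, b, hb, ?_⟩
      rw [dt_swap]; linarith
    · exact ⟨a, ha, b, hb, c, hc, h'⟩
  have haS := h.ext_sub ha
  have hbS := h.ext_sub hb
  have hcS := h.ext_sub hc
  have hai := ext_not_int ha
  have hbi := ext_not_int hb
  have hci := ext_not_int hc
  have D2 : 0 < dt (c - b) (a - b) := by rw [dt_rot]; exact hD
  have D3 : 0 < dt (a - c) (b - c) := by rw [dt_rot]; exact D2
  have hbary : ∀ x ∈ P, 0 ≤ dt (x - a) (c - a) ∧ 0 ≤ dt (b - a) (x - a) ∧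
      dt (x - a) (c - a) + dt (b - a) (x - a) ≤ dt (b - a) (c - a) := by
    intro x hx
    have s1 := side h.cvx h.int haS.1 hbS.1 hcS.1 hD.ne' (hno a haS b hbS hai hbi) hx
    have s2 := side h.cvx h.int hbS.1 hcS.1 haS.1 D2.ne' (hno b hbS c hcS hbi hci) hx
    have s3 := side h.cvx h.int hcS.1 haS.1 hbS.1 D3.ne' (hno c hcS a haS hci hai) hx
    have s1 := (div_nonneg_iff_of_pos hD).1 s1
    have s2 := (div_nonneg_iff_of_pos D2).1 s2
    have s3 := (div_nonneg_iff_of_pos D3).1 s3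
    refine ⟨?_, s1, ?_⟩ <;> simp only [dt, Pi.sub_apply] at * <;> linarith
  have hPe : P = convexHull ℝ ({a, b, c} : Set E2) := by
    apply Set.Subset.antisymm
    · intro x hx; exact (mem_tri' hD).2 (hbary x hx)
    · refine convexHull_min ?_ h.cvx
      rintro x (rfl | rfl | rfl)
      exacts [haS.1, hbS.1, hcS.1]
  refine pick_base hPe haS.2 hbS.2 hcS.2 hD ?_
  intro x hx hxi
  have hx1 := hx.1
  rw [hPe, mem_tri] at hx1
  obtain ⟨s, t, hs, ht, hst, hxe⟩ := hx1
  by_contra hne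
  push Not at hne
  obtain ⟨hxa, hxb, hxc⟩ := hne
  rcases hs.eq_or_lt with hs0 | hs0
  · -- on edge ac
    subst hs0
    have ht0 : 0 < t := lt_of_le_of_ne ht (by rintro rfl; apply hxa; rw [hxe]; simp)
    have ht1 : t < 1 := lt_of_le_of_ne (by linarith) (by rintro rfl; apply hxc; rw [hxe]; simp)
    apply hno x hx b hbS hxi hbi
    have := tri_interior h.cvx haS.1 hbS.1 hcS.1 hD.ne' (s := 1/2) (t := t/2) (by norm_num) (by linarith) (by linarith)
    convert this using 1
    rw [hxe]; module
  rcases ht.eq_or_lt with ht0 | ht0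
  · subst ht0
    have hs1 : s < 1 := lt_of_le_of_ne (by linarith) (by rintro rfl; apply hxb; rw [hxe]; simp)
    apply hno x hx c hcS hxi hci
    have := tri_interior h.cvx haS.1 hbS.1 hcS.1 hD.ne' (s := s/2) (t := 1/2) (by linarith) (by norm_num) (by linarith)
    convert this using 1
    rw [hxe]; module
  rcases hst.eq_or_lt with h1 | h1
  · apply hno x hx a haS hxi hai
    have := tri_interior h.cvx haS.1 hbS.1 hcS.1 hD.ne' (s := s/2) (t := t/2) (by linarith) (by linarith) (by linarith)
    convert this using 1
    rw [hxe]; module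
  · apply hxi
    rw [hxe]
    exact tri_interior h.cvx haS.1 hbS.1 hcS.1 hD.ne' hs0 ht0 h1

/-- the part of `P` on one side of the line `xy` -/
def half (P : Set E2) (x y : E2) : Set E2 := P ∩ {z | dt (y - x) (z - x) ≤ 0}

lemma dt_aff (u x : E2) (p q : E2) (s t : ℝ) (hst : s + t = 1) :
    dt u (s • p + t • q - x) = s * dt u (p - x) + t * dt u (q - x) := by
  have : t = 1 - s := by linarith
  subst this
  simp only [dt, Pi.sub_apply, Pi.add_apply, Pi.smul_apply, smul_eq_mul]; ring

lemma dt_cont (u x : E2) : Continuous fun z : E2 => dt u (z - x) := by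
  unfold dt; simp only [Pi.sub_apply]; fun_prop

lemma half_interior {P : Set E2} {x y : E2} (hxy : y - x ≠ 0) :
    interior (half P x y) = interior P ∩ {z | dt (y - x) (z - x) < 0} := by
  apply Set.Subset.antisymm
  · intro z hz
    refine ⟨interior_mono Set.inter_subset_left hz, ?_⟩
    have h1 : dt (y - x) (z - x) ≤ 0 := (interior_subset hz).2
    refine lt_of_le_of_ne h1 (fun h0 => dtL_ne_zero hxy (no_int_max hz fun p hp => ?_))
    have h2 : dt (y - x) (p - x) ≤ 0 := hp.2
    rw [← dtL_apply, map_sub] at h0 h2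
    linarith
  · apply interior_maximal
    · rintro z ⟨h1, h2⟩; exact ⟨interior_subset h1, (show dt (y - x) (z - x) < 0 from h2).le⟩
    · exact isOpen_interior.inter (isOpen_lt (dt_cont _ _) continuous_const)

/-- a chord -/
structure Chord (P : Set E2) (x y : E2) : Prop where
  xS : x ∈ P ∩ Lat2
  yS : y ∈ P ∩ Lat2
  xi : x ∉ interior P
  yi : y ∉ interior P
  mid : (1/2 : ℝ) • x + (1/2 : ℝ) • y ∈ interior P

lemma Chord.symm {P : Set E2} {x y : E2} (h : Chord P x y) : Chord P y x :=
  ⟨h.yS, h.xS, h.yi, h.xi, by rw [add_comm]; exact h.mid⟩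

lemma Chord.ne {P : Set E2} {x y : E2} (h : Chord P x y) : y - x ≠ 0 := by
  intro h0
  have : y = x := sub_eq_zero.1 h0
  subst this
  apply h.xi
  have := h.mid
  rwa [← add_smul, show (1/2 + 1/2 : ℝ) = 1 by norm_num, one_smul] at this

lemma Chord.line {P : Set E2} (hP : LP P) {x y : E2} (h : Chord P x y) {z : E2} (hz : z ∈ P)
    (h0 : dt (y - x) (z - x) = 0) : ∃ t : ℝ, 0 ≤ t ∧ t ≤ 1 ∧ z = x + t • (y - x) := by
  -- parametrise
  obtain ⟨t, ht⟩ : ∃ t : ℝ, z = x + t • (y - x) := by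
    have hne := h.ne
    have : (y - x) 0 ≠ 0 ∨ (y - x) 1 ≠ 0 := by
      by_contra hc; push Not at hc
      apply hne; ext i; fin_cases i <;> simp [hc.1, hc.2]
    simp only [dt, Pi.sub_apply] at h0 this
    rcases this with hu | hu
    · refine ⟨(z 0 - x 0) / (y 0 - x 0), ?_⟩
      ext i; fin_cases i <;> simp <;> field_simp <;> linarith
    · refine ⟨(z 1 - x 1) / (y 1 - x 1), ?_⟩
      ext i; fin_cases i <;> simp <;> field_simp <;> linarith
  refine ⟨t, ?_, ?_, ht⟩
  · by_contra hneg
    push Not at hneg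
    apply h.xi
    have := hP.cvx.openSegment_interior_self_subset_interior h.mid hz
    apply this
    have hd : 1 - 2 * t ≠ 0 := by linarith
    refine ⟨(-2 * t) / (1 - 2 * t), 1 / (1 - 2 * t), div_pos (by linarith) (by linarith),
      div_pos (by norm_num) (by linarith), by field_simp; ring, ?_⟩
    rw [ht]
    ext i
    simp only [Pi.add_apply, Pi.smul_apply, smul_eq_mul, Pi.sub_apply]
    field_simp
    ring
  · by_contra hneg
    push Not at hneg
    apply h.yi
    have := hP.cvx.openSegment_interior_self_subset_interior h.mid hz
    apply this
    have hd : 2 * t - 1 ≠ 0 := by linarith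
    refine ⟨(2 * t - 2) / (2 * t - 1), 1 / (2 * t - 1), div_pos (by linarith) (by linarith),
      div_pos (by norm_num) (by linarith), by field_simp; ring, ?_⟩
    rw [ht]
    ext i
    simp only [Pi.add_apply, Pi.smul_apply, smul_eq_mul, Pi.sub_apply]
    field_simp
    ring

lemma dt_flip (x y z : E2) : dt (x - y) (z - y) = - dt (y - x) (z - x) := by
  simp [dt]; ring

lemma dt_mid (x y : E2) : dt (y - x) ((1/2 : ℝ) • x + (1/2 : ℝ) • y - x) = 0 := by
  simp [dt]; ring

lemma Chord.exists_neg {P : Set E2} {x y : E2} (h : Chord P x y) :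
    ∃ z ∈ interior P, dt (y - x) (z - x) < 0 := by
  by_contra! hc
  have hm : (1/2 : ℝ) • x + (1/2 : ℝ) • y ∈ interior (interior P) := by
    rw [interior_interior]; exact h.mid
  refine dtL_ne_zero h.ne (no_int_min hm fun p hp => ?_)
  have h1 := hc p hp
  have h2 := dt_mid x y
  rw [← dtL_apply, map_sub] at h1 h2
  linarith

lemma dt_convex_le (u x : E2) : Convex ℝ {z : E2 | dt u (z - x) ≤ 0} := by
  intro p hp q hq s t hs ht hst
  have hp : dt u (p - x) ≤ 0 := hp
  have hq : dt u (q - x) ≤ 0 := hq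
  change dt u (s • p + t • q - x) ≤ 0
  rw [dt_aff _ _ _ _ _ _ hst]; nlinarith

lemma dt_convex_gt (u x : E2) : Convex ℝ {z : E2 | 0 < dt u (z - x)} := by
  intro p hp q hq s t hs ht hst
  have hp : 0 < dt u (p - x) := hp
  have hq : 0 < dt u (q - x) := hq
  change 0 < dt u (s • p + t • q - x)
  rw [dt_aff _ _ _ _ _ _ hst]
  rcases hs.eq_or_lt with h | h
  · subst h; have : t = 1 := by linarith
    subst this; simpa using hq
  · have := mul_pos h hp
    have := mul_nonneg ht hq.le
    linarith

lemma Chord.half_LP {P : Set E2} (hP : LP P) {x y : E2} (h : Chord P x y) : LP (half P x y) := by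
  have hx1 : x ∈ half P x y ∩ Lat2 := ⟨⟨h.xS.1, by simp [dt]⟩, h.xS.2⟩
  have hy1 : y ∈ half P x y ∩ Lat2 := ⟨⟨h.yS.1, by simp [dt]; linarith⟩, h.yS.2⟩
  refine ⟨?_, ?_, ?_, ?_⟩
  · exact hP.cpt.inter_right (isClosed_le (dt_cont _ _) continuous_const)
  · exact hP.cvx.inter (dt_convex_le _ _)
  · rintro p ⟨hpP, hpd⟩
    have hpd : dt (y - x) (p - x) ≤ 0 := hpd
    have hSeq : P ∩ Lat2 = (half P x y ∩ Lat2) ∪ (P ∩ Lat2 ∩ {z | 0 < dt (y - x) (z - x)}) := by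
      ext z
      constructor
      · intro hz
        rcases le_or_gt (dt (y - x) (z - x)) 0 with h1 | h1
        · left; exact ⟨⟨hz.1, h1⟩, hz.2⟩
        · right; exact ⟨hz, h1⟩
      · rintro (hz | hz)
        · exact ⟨hz.1.1, hz.2⟩
        · exact hz.1
    have hp := hP.hull hpP
    rw [hSeq] at hp
    rcases Set.eq_empty_or_nonempty (P ∩ Lat2 ∩ {z | 0 < dt (y - x) (z - x)}) with he | hne
    · rwa [he, Set.union_empty] at hp
    rw [convexHull_union ⟨x, hx1⟩ hne, mem_convexJoin] at hp
    obtain ⟨q, hq, r, hr, α, β, hα, hβ, hαβ, rfl⟩ := hp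
    have hqd : dt (y - x) (q - x) ≤ 0 :=
      convexHull_min (fun z hz => hz.1.2) (dt_convex_le _ _) hq
    have hrd : 0 < dt (y - x) (r - x) :=
      convexHull_min (fun z hz => hz.2) (dt_convex_gt _ _) hr
    have hqP : q ∈ P := convexHull_min (fun z hz => hz.1.1) hP.cvx hq
    have hrP : r ∈ P := convexHull_min (fun z hz => hz.1.1) hP.cvx hr
    rw [dt_aff _ _ _ _ _ _ hαβ] at hpd
    set fq := dt (y - x) (q - x) with hfq
    set fr := dt (y - x) (r - x) with hfr
    rcases hqd.eq_or_lt with h0 | h0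
    · have : β = 0 := by
        rw [h0] at hpd
        nlinarith
      subst this
      have : α = 1 := by linarith
      subst this
      simpa using hq
    · have hd : fr - fq ≠ 0 := by linarith
      have hdp : 0 < fr - fq := by linarith
      have hsum : fr / (fr - fq) + (-fq) / (fr - fq) = 1 := by field_simp; ring
      have hzP : (fr / (fr - fq)) • q + ((-fq) / (fr - fq)) • r ∈ P :=
        hP.cvx hqP hrP (div_nonneg hrd.le hdp.le) (div_nonneg (by linarith) hdp.le) hsum
      have hz0 : dt (y - x) ((fr / (fr - fq)) • q + ((-fq) / (fr - fq)) • r - x) = 0 := by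
        rw [dt_aff _ _ _ _ _ _ hsum, ← hfq, ← hfr]; field_simp; ring
      obtain ⟨t, ht0, ht1, hzt⟩ := h.line hP hzP hz0
      have hzh : (fr / (fr - fq)) • q + ((-fq) / (fr - fq)) • r ∈ convexHull ℝ (half P x y ∩ Lat2) := by
        rw [hzt]
        have := convex_convexHull ℝ (half P x y ∩ Lat2) (subset_convexHull ℝ _ hx1)
          (subset_convexHull ℝ _ hy1) (show 0 ≤ 1 - t by linarith) ht0 (by ring)
        convert this using 1
        module
      have hμ1 : β * (fr - fq) / (-fq) ≤ 1 := by
        rw [div_le_one (by linarith)]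
        have : α = 1 - β := by linarith
        subst this
        linarith
      have hμ0 : 0 ≤ β * (fr - fq) / (-fq) := div_nonneg (mul_nonneg hβ hdp.le) (by linarith)
      have := convex_convexHull ℝ (half P x y ∩ Lat2) hq hzh
        (show 0 ≤ 1 - β * (fr - fq) / (-fq) by linarith) hμ0 (by ring)
      convert this using 1
      have hq0 : fq ≠ 0 := h0.ne
      have : α = 1 - β := by linarith
      subst this
      ext i
      simp only [Pi.add_apply, Pi.smul_apply, smul_eq_mul]
      field_simp
      ring
  · rw [half_interior h.ne]
    obtain ⟨z, hz, hz'⟩ := h.exists_neg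
    exact ⟨z, hz, hz'⟩

lemma Chord.half_lt {P : Set E2} (hP : LP P) {x y : E2} (h : Chord P x y) :
    (half P x y ∩ Lat2).ncard < (P ∩ Lat2).ncard := by
  apply Set.ncard_lt_ncard _ hP.finite
  refine ⟨fun z hz => ⟨hz.1.1, hz.2⟩, fun hsub => ?_⟩
  obtain ⟨z, hz, hz'⟩ := h.symm.exists_neg
  have : P ⊆ {z | dt (y - x) (z - x) ≤ 0} := by
    rw [← hP.eq]
    exact convexHull_min (fun z hz => (hsub hz).1.2) (dt_convex_le _ _)
  have h1 : dt (y - x) (z - x) ≤ 0 := this (interior_subset hz)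
  rw [dt_flip] at hz'
  linarith

lemma mem_half {P : Set E2} {x y z : E2} : z ∈ half P x y ↔ z ∈ P ∧ dt (y - x) (z - x) ≤ 0 := Iff.rfl

lemma mem_half' {P : Set E2} {x y z : E2} : z ∈ half P y x ↔ z ∈ P ∧ 0 ≤ dt (y - x) (z - x) := by
  rw [mem_half, dt_flip]; simp

theorem pick {P : Set E2} (hP : LP P) :
    2 * (volume P).toReal = (P ∩ Lat2).ncard + (interior P ∩ Lat2).ncard - 2 := by
  induction hn : (P ∩ Lat2).ncard using Nat.strong_induction_on generalizing P with
  | _ n ih =>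
  subst hn
  by_cases hch : ∃ x y, Chord P x y
  swap
  · apply no_chord hP
    intro x hx y hy hxi hyi hm
    exact hch ⟨x, y, hx, hy, hxi, hyi, hm⟩
  obtain ⟨x, y, h⟩ := hch
  have i1 := ih _ (h.half_lt hP) (h.half_LP hP) rfl
  have i2 := ih _ (h.symm.half_lt hP) (h.symm.half_LP hP) rfl
  have hLP1 := h.half_LP hP
  have hLP2 := h.symm.half_LP hP
  have hfin := hP.finite
  -- volume
  have hPu : P = half P x y ∪ half P y x := by
    ext z
    rw [Set.mem_union, mem_half, mem_half']
    constructor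
    · intro hz
      rcases le_total (dt (y - x) (z - x)) 0 with h1 | h1
      · exact Or.inl ⟨hz, h1⟩
      · exact Or.inr ⟨hz, h1⟩
    · rintro (h | h) <;> exact h.1
  have hvol : (volume P).toReal = (volume (half P x y)).toReal + (volume (half P y x)).toReal := by
    have hnull : volume (half P x y ∩ half P y x) = 0 := by
      refine measure_mono_null ?_ (line_null (dtL_ne_zero h.ne) (dtL (y - x) x))
      rintro z ⟨h1, h2⟩
      have h1 := (mem_half.1 h1).2
      have h2 := (mem_half'.1 h2).2
      rw [← dtL_apply, map_sub] at h1 h2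
      change dtL (y - x) z = dtL (y - x) x
      linarith
    have := measure_union_add_inter (μ := volume) (half P x y) (hLP2.cpt.measurableSet)
    rw [hnull, add_zero, ← hPu] at this
    rw [this, ENNReal.toReal_add hLP1.cpt.measure_lt_top.ne hLP2.cpt.measure_lt_top.ne]
  -- lattice points
  set M := interior P ∩ Lat2 ∩ {z | dt (y - x) (z - x) = 0} with hM
  have hMfin : M.Finite := hfin.subset (fun z hz => ⟨interior_subset hz.1.1, hz.1.2⟩)
  have hxyne : x ≠ y := fun e => h.ne (by rw [e, sub_self])
  have hinter : (half P x y ∩ Lat2) ∩ (half P y x ∩ Lat2) = M ∪ {x, y} := by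
    ext z
    constructor
    · rintro ⟨⟨h1, hL⟩, h2, -⟩
      have h0 : dt (y - x) (z - x) = 0 := le_antisymm (mem_half.1 h1).2 (mem_half'.1 h2).2
      obtain ⟨t, ht0, ht1, hzt⟩ := h.line hP h1.1 h0
      rcases ht0.eq_or_lt with h3 | h3
      · right; left; rw [hzt, ← h3]; simp
      rcases ht1.eq_or_lt with h4 | h4
      · right; right; rw [hzt, h4]; simp
      left
      refine ⟨⟨?_, hL⟩, h0⟩
      rcases le_total t (1/2) with h5 | h5
      · have := hP.cvx.openSegment_self_interior_subset_interior h.xS.1 h.mid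
        rcases h5.eq_or_lt with h6 | h6
        · convert h.mid using 1
          rw [hzt, h6]; module
        apply this
        refine ⟨1 - 2 * t, 2 * t, by linarith, by linarith, by ring, ?_⟩
        rw [hzt]; module
      · have := hP.cvx.openSegment_self_interior_subset_interior h.yS.1 h.mid
        rcases h5.eq_or_lt with h6 | h6
        · convert h.mid using 1
          rw [hzt, ← h6]; module
        apply this
        refine ⟨2 * t - 1, 2 - 2 * t, by linarith, by linarith, by ring, ?_⟩
        rw [hzt]; module
    · rintro (hz | hz | hz)
      · have h0 : dt (y - x) (z - x) = 0 := hz.2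
        exact ⟨⟨mem_half.2 ⟨interior_subset hz.1.1, h0.le⟩, hz.1.2⟩,
          ⟨mem_half'.2 ⟨interior_subset hz.1.1, h0.ge⟩, hz.1.2⟩⟩
      · subst hz
        exact ⟨⟨mem_half.2 ⟨h.xS.1, by simp [dt]⟩, h.xS.2⟩, ⟨mem_half'.2 ⟨h.xS.1, by simp [dt]⟩, h.xS.2⟩⟩
      · have hz : z = y := hz
        subst hz
        exact ⟨⟨mem_half.2 ⟨h.yS.1, by simp [dt]; linarith⟩, h.yS.2⟩,
          ⟨mem_half'.2 ⟨h.yS.1, by simp [dt]; linarith⟩, h.yS.2⟩⟩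
  have hdisj : Disjoint M {x, y} := by
    rw [Set.disjoint_right]
    rintro z (rfl | hz) hzM
    · exact h.xi hzM.1.1
    · have hz : z = y := hz
      subst hz; exact h.yi hzM.1.1
  have c1 : (half P x y ∩ Lat2).ncard + (half P y x ∩ Lat2).ncard = (P ∩ Lat2).ncard + (M.ncard + 2) := by
    rw [← Set.ncard_union_add_ncard_inter _ _ hLP1.finite hLP2.finite, hinter,
      Set.ncard_union_eq hdisj hMfin (by simp), Set.ncard_pair hxyne, ← Set.union_inter_distrib_right, ← hPu]
  have hint1 := half_interior (P := P) h.ne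
  have hint2 := half_interior (P := P) h.symm.ne
  have hfi1 : (interior (half P x y) ∩ Lat2).Finite :=
    hLP1.finite.subset (Set.inter_subset_inter_left _ interior_subset)
  have hfi2 : (interior (half P y x) ∩ Lat2).Finite :=
    hLP2.finite.subset (Set.inter_subset_inter_left _ interior_subset)
  have hidec : interior P ∩ Lat2 = (interior (half P x y) ∩ Lat2) ∪ ((interior (half P y x) ∩ Lat2) ∪ M) := by
    rw [hint1, hint2]
    ext z
    simp only [Set.mem_union, Set.mem_inter_iff, Set.mem_ofPred_eq, hM, dt_flip x y z]
    constructor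
    · rintro ⟨h1, h2⟩
      rcases lt_trichotomy (dt (y - x) (z - x)) 0 with h3 | h3 | h3
      · left; exact ⟨⟨h1, h3⟩, h2⟩
      · right; right; exact ⟨⟨h1, h2⟩, h3⟩
      · right; left; exact ⟨⟨h1, by linarith⟩, h2⟩
    · rintro (⟨⟨h1, -⟩, h2⟩ | ⟨⟨h1, -⟩, h2⟩ | ⟨⟨h1, h2⟩, -⟩) <;> exact ⟨h1, h2⟩
  have c2 : (interior P ∩ Lat2).ncard = (interior (half P x y) ∩ Lat2).ncard +
      ((interior (half P y x) ∩ Lat2).ncard + M.ncard) := by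
    rw [hidec, Set.ncard_union_eq _ hfi1 (hfi2.union hMfin), Set.ncard_union_eq _ hfi2 hMfin]
    · rw [Set.disjoint_left]
      intro z hz hz'
      rw [hint2] at hz
      have h1 : dt (x - y) (z - y) < 0 := hz.1.2
      have h2 : dt (y - x) (z - x) = 0 := hz'.2
      rw [dt_flip] at h1; linarith
    · rw [Set.disjoint_left]
      intro z hz hz'
      rw [hint1] at hz
      have h1 : dt (y - x) (z - x) < 0 := hz.1.2
      rcases hz' with hz' | hz'
      · rw [hint2] at hz'
        have h2 : dt (x - y) (z - y) < 0 := hz'.1.2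
        rw [dt_flip] at h2; linarith
      · have h2 : dt (y - x) (z - x) = 0 := hz'.2
        linarith
  have c1' : ((half P x y ∩ Lat2).ncard : ℝ) + (half P y x ∩ Lat2).ncard = (P ∩ Lat2).ncard + (M.ncard + 2) := by
    exact_mod_cast c1
  have c2' : ((interior P ∩ Lat2).ncard : ℝ) = (interior (half P x y) ∩ Lat2).ncard +
      ((interior (half P y x) ∩ Lat2).ncard + M.ncard) := by exact_mod_cast c2
  rw [hvol]
  linarith

/-- the hull of the lattice points other than `v` -/
def Pv (P : Set E2) (v : E2) : Set E2 := convexHull ℝ ((P ∩ Lat2) \ {v})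

lemma K_scale {σ : Set E2} (hσ : ∀ x ∈ σ, ∀ n : ℕ, (n : ℝ) • x ∈ σ) {y : E2}
    (hy : y ∈ convexHull ℝ ((σ \ {0}) ∩ Lat2)) {t : ℝ} (ht : 1 ≤ t) :
    t • y ∈ convexHull ℝ ((σ \ {0}) ∩ Lat2) := by
  have hc : Convex ℝ {y : E2 | t • y ∈ convexHull ℝ ((σ \ {0}) ∩ Lat2)} := by
    intro p hp q hq a b ha hb hab
    have := convex_convexHull ℝ ((σ \ {0}) ∩ Lat2) hp hq ha hb hab
    change t • (a • p + b • q) ∈ convexHull ℝ ((σ \ {0}) ∩ Lat2)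
    convert this using 1
    module
  refine convexHull_min ?_ hc hy
  intro z hz
  obtain ⟨n, hn⟩ := exists_nat_ge t
  have hn1 : (1 : ℝ) ≤ n := ht.trans hn
  have hzn : (n : ℝ) • z ∈ (σ \ {0}) ∩ Lat2 := by
    refine ⟨⟨hσ z hz.1.1 n, ?_⟩, by simpa using lat_zsmul hz.2 n⟩
    have hz0 : z ≠ 0 := hz.1.2
    simp only [Set.mem_singleton_iff, smul_eq_zero, not_or]
    exact ⟨by linarith, hz0⟩
  change t • z ∈ convexHull ℝ ((σ \ {0}) ∩ Lat2)
  rcases hn1.eq_or_lt with h1 | h1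
  · have : t = 1 := by linarith
    rw [this, one_smul]; exact subset_convexHull ℝ _ hz
  · have hd : (n : ℝ) - 1 ≠ 0 := by linarith
    have := convex_convexHull ℝ ((σ \ {0}) ∩ Lat2) (subset_convexHull ℝ _ hz) (subset_convexHull ℝ _ hzn)
      (a := (n - t) / (n - 1)) (b := (t - 1) / (n - 1)) (div_nonneg (by linarith) (by linarith))
      (div_nonneg (by linarith) (by linarith)) (by field_simp; ring)
    convert this using 1
    rw [smul_smul, ← add_smul]
    congr 1
    field_simp; ring

lemma cone_nsmul (P : Set E2) (v : E2) : ∀ x ∈ coneAt P v, ∀ n : ℕ, (n : ℝ) • x ∈ coneAt P v := by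
  rintro x ⟨t, ht, p, hp, rfl⟩ n
  exact ⟨n * t, by positivity, p, hp, by rw [smul_smul]⟩

lemma LP.Pv_sub {P : Set E2} (hP : LP P) (v : E2) : Pv P v ⊆ P :=
  convexHull_min (fun _ hz => hz.1.1) hP.cvx

lemma LP.Pv_cpt {P : Set E2} (hP : LP P) (v : E2) : IsCompact (Pv P v) :=
  Set.Finite.isCompact_convexHull ℝ (hP.finite.subset Set.sdiff_subset)

lemma LP.notMem_Pv {P : Set E2} (hP : LP P) {v : E2} (hv : v ∈ Set.extremePoints ℝ P) :
    v ∉ Pv P v := by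
  intro h
  have := (hP.cvx.mem_extremePoints_iff_mem_sdiff_convexHull_sdiff.1 hv).2
  have hsub : (P ∩ Lat2) \ {v} ⊆ P \ {v} := fun z hz => ⟨hz.1.1, hz.2⟩
  exact this (convexHull_mono hsub h)

lemma LP.Pv_lat {P : Set E2} (hP : LP P) {v : E2} (hv : v ∈ Set.extremePoints ℝ P) :
    Pv P v ∩ Lat2 = (P ∩ Lat2) \ {v} := by
  ext z
  constructor
  · rintro ⟨h1, h2⟩
    refine ⟨⟨hP.Pv_sub v h1, h2⟩, ?_⟩
    rintro rfl
    exact hP.notMem_Pv hv h1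
  · rintro h
    exact ⟨subset_convexHull ℝ _ h, h.1.2⟩

lemma LP.Pv_LP {P : Set E2} (hP : LP P) {v : E2} (hv : v ∈ Set.extremePoints ℝ P)
    (hi : (interior (Pv P v)).Nonempty) : LP (Pv P v) :=
  ⟨hP.Pv_cpt v, convex_convexHull ℝ _, by rw [hP.Pv_lat hv]; exact subset_rfl, hi⟩

lemma LP.other {P : Set E2} (hP : LP P) (v : E2) : ((P ∩ Lat2) \ {v}).Nonempty := by
  obtain ⟨a, ha, b, hb, c, hc, hD⟩ := hP.ext_triple
  by_cases h : a = v
  · refine ⟨b, hP.ext_sub hb, ?_⟩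
    rintro rfl
    apply hD; rw [h]; simp [dt]
  · exact ⟨a, hP.ext_sub ha, h⟩

lemma RSV_le {P : Set E2} (hP : LP P) {v : E2} (hv : v ∈ Set.extremePoints ℝ P) :
    RSV (coneAt P v) ≤ 2 * (volume P).toReal - 2 * (volume (Pv P v)).toReal := by
  have hvS := hP.ext_sub hv
  have hK : ∀ q ∈ Pv P v, q - v ∈ convexHull ℝ ((coneAt P v \ {0}) ∩ Lat2) := by
    have hc : Convex ℝ {q : E2 | q - v ∈ convexHull ℝ ((coneAt P v \ {0}) ∩ Lat2)} := by
      intro p hp q hq a b ha hb hab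
      have := convex_convexHull ℝ ((coneAt P v \ {0}) ∩ Lat2) hp hq ha hb hab
      change (a • p + b • q) - v ∈ convexHull ℝ ((coneAt P v \ {0}) ∩ Lat2)
      convert this using 1
      have : b = 1 - a := by linarith
      subst this
      module
    refine convexHull_min ?_ hc
    rintro s ⟨hs, hsv⟩
    apply subset_convexHull ℝ _
    exact ⟨⟨⟨1, zero_le_one, s, hs.1, by simp⟩, by simpa [sub_eq_zero] using hsv⟩, lat_sub hs.2 hvS.2⟩
  have hsub : coneAt P v \ convexHull ℝ ((coneAt P v \ {0}) ∩ Lat2) ⊆ (fun x => x + v) ⁻¹' (P \ Pv P v) := by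
    rintro x ⟨⟨t, ht, p, hp, rfl⟩, hxK⟩
    refine ⟨?_, fun hmem => hxK (by simpa using hK _ hmem)⟩
    have hp' := hP.hull hp
    rw [← Set.insert_sdiff_self_of_mem hvS, convexHull_insert (hP.other v), mem_convexJoin] at hp'
    obtain ⟨v', hv', q, hq, α, β, hα, hβ, hαβ, hpe⟩ := hp'
    have : v' = v := hv'
    subst this
    have hα' : α = 1 - β := by linarith
    have hx : t • (p - v') = (t * β) • (q - v') := by
      rw [← hpe, hα']; module
    rcases le_total (t * β) 1 with h1 | h1
    · change t • (p - v') + v' ∈ P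
      have := hP.cvx hvS.1 (hP.Pv_sub v' hq) (show 0 ≤ 1 - t * β by linarith) (mul_nonneg ht hβ) (by ring)
      convert this using 1
      rw [hx]; module
    · exfalso
      apply hxK
      rw [hx]
      exact K_scale (cone_nsmul P v') (hK q hq) h1
  have hm : volume (coneAt P v \ convexHull ℝ ((coneAt P v \ {0}) ∩ Lat2)) ≤ volume (P \ Pv P v) := by
    refine (measure_mono hsub).trans ?_
    rw [measure_preimage_add_right]
  have hfin : volume (P \ Pv P v) ≠ ⊤ := ((measure_mono Set.sdiff_subset).trans_lt hP.cpt.measure_lt_top).ne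
  have h1 := ENNReal.toReal_mono hfin hm
  have h2 : (volume (P \ Pv P v)).toReal = (volume P).toReal - (volume (Pv P v)).toReal := by
    rw [measure_sdiff (hP.Pv_sub v) (hP.Pv_cpt v).measurableSet.nullMeasurableSet (hP.Pv_cpt v).measure_lt_top.ne]
    exact ENNReal.toReal_sub_of_le (measure_mono (hP.Pv_sub v)) hP.cpt.measure_lt_top.ne
  rw [h2] at h1
  unfold RSV
  linarith

/-- at most four vectors in the plane are pairwise obtuse in the sense of a system of functionals -/
lemma obtuse {R : Finset E2} (w : E2 → E2) (f : E2 → (E2 →L[ℝ] ℝ))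
    (h1 : ∀ v ∈ R, 0 < f v (w v)) (h2 : ∀ v ∈ R, ∀ u ∈ R, u ≠ v → f v (w u) ≤ 0) : R.card ≤ 4 := by
  rcases R.eq_empty_or_nonempty with rfl | ⟨u, hu⟩
  · simp
  have key : ∀ z1 ∈ R, ∀ z2 ∈ R, z1 ≠ u → z2 ≠ u → z1 ≠ z2 →
      0 < dt (w u) (w z1) * dt (w u) (w z2) → 0 ≤ dt (w u) (w z1) * dt (w z1) (w z2) → False := by
    intro z1 hz1 z2 hz2 h1u h2u h12 hpos hnn
    have id1 : (dt (w u) (w z1) * dt (w u) (w z2)) • w z1 =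
        (dt (w u) (w z1) * dt (w z1) (w z2)) • w u + (dt (w u) (w z1) ^ 2) • w z2 := by
      ext i; fin_cases i <;> simp [dt] <;> ring
    have := congrArg (f z1) id1
    simp only [map_add, map_smul, smul_eq_mul] at this
    have a1 := mul_pos hpos (h1 z1 hz1)
    have a2 := mul_nonpos_of_nonneg_of_nonpos hnn (h2 z1 hz1 u hu h1u.symm)
    have a3 := mul_nonpos_of_nonneg_of_nonpos (sq_nonneg (dt (w u) (w z1))) (h2 z1 hz1 z2 hz2 h12.symm)
    linarith
  have hinj : Set.InjOn (fun z => SignType.sign (dt (w u) (w z))) ((R.erase u : Finset E2) : Set E2) := by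
    intro z1 hz1 z2 hz2 hs
    by_contra h12
    simp only [Finset.coe_erase, Set.mem_sdiff, Finset.mem_coe, Set.mem_singleton_iff] at hz1 hz2
    obtain ⟨hz1, h1u⟩ := hz1
    obtain ⟨hz2, h2u⟩ := hz2
    simp only at hs
    have hanti : dt (w z2) (w z1) = - dt (w z1) (w z2) := by simp [dt]; ring
    rcases lt_trichotomy (dt (w u) (w z1)) 0 with h | h | h
    · rw [sign_neg h, eq_comm, sign_eq_neg_one_iff] at hs
      rcases le_total (dt (w z1) (w z2)) 0 with h' | h'
      · exact key z1 hz1 z2 hz2 h1u h2u h12 (mul_pos_of_neg_of_neg h hs) (mul_nonneg_of_nonpos_of_nonpos h.le h')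
      · exact key z2 hz2 z1 hz1 h2u h1u (Ne.symm h12) (mul_pos_of_neg_of_neg hs h)
          (mul_nonneg_of_nonpos_of_nonpos hs.le (by linarith))
    · rw [h, sign_zero, eq_comm, sign_eq_zero_iff] at hs
      have hu0 : w u ≠ 0 := by intro h0; have := h1 u hu; rw [h0] at this; simp at this
      have par : ∀ z ∈ R, z ≠ u → dt (w u) (w z) = 0 → ∃ s : ℝ, s < 0 ∧ w z = s • w u := by
        intro z hz hzu h0
        have hz0 : w z ≠ 0 := by intro h0; have := h1 z hz; rw [h0] at this; simp at this
        obtain ⟨s, hs⟩ : ∃ s : ℝ, w z = s • w u := by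
          have : (w u) 0 ≠ 0 ∨ (w u) 1 ≠ 0 := by
            by_contra hc; push Not at hc
            apply hu0; ext i; fin_cases i <;> simp [hc.1, hc.2]
          simp only [dt] at h0
          rcases this with hh | hh
          · refine ⟨w z 0 / w u 0, ?_⟩
            ext i; fin_cases i <;> simp <;> field_simp <;> linarith
          · refine ⟨w z 1 / w u 1, ?_⟩
            ext i; fin_cases i <;> simp <;> field_simp <;> linarith
        refine ⟨s, ?_, hs⟩
        have hle := h2 u hu z hz hzu
        rw [hs, map_smul, smul_eq_mul] at hle
        have hs0 : s ≠ 0 := by rintro rfl; apply hz0; rw [hs]; simp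
        have := h1 u hu
        by_contra hc
        push Not at hc
        have : 0 < s := lt_of_le_of_ne hc hs0.symm
        nlinarith [mul_pos this (h1 u hu)]
      obtain ⟨s, hs0, hse⟩ := par z1 hz1 h1u h
      obtain ⟨t, ht0, hte⟩ := par z2 hz2 h2u hs
      have g1 := h1 z1 hz1
      have g2 := h2 z1 hz1 z2 hz2 (Ne.symm h12)
      rw [hse, map_smul, smul_eq_mul] at g1
      rw [hte, map_smul, smul_eq_mul] at g2
      have : f z1 (w u) < 0 := by
        by_contra hc; push Not at hc; nlinarith
      nlinarith [mul_pos_of_neg_of_neg ht0 this]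
    · rw [sign_pos h, eq_comm, sign_eq_one_iff] at hs
      rcases le_total (dt (w z1) (w z2)) 0 with h' | h'
      · exact key z2 hz2 z1 hz1 h2u h1u (Ne.symm h12) (mul_pos hs h) (mul_nonneg hs.le (by linarith))
      · exact key z1 hz1 z2 hz2 h1u h2u h12 (mul_pos h hs) (mul_nonneg h.le h')
  have hcard : (R.erase u).card ≤ (Finset.univ : Finset SignType).card :=
    Finset.card_le_card_of_injOn _ (fun _ _ => Finset.mem_univ _) hinj
  rw [Finset.card_erase_of_mem hu] at hcard
  have : (Finset.univ : Finset SignType).card = 3 := by decide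
  omega

lemma frontier_card {P : Set E2} (hP : LP P) :
    ((frontier P ∩ Lat2).ncard : ℝ) = (P ∩ Lat2).ncard - (interior P ∩ Lat2).ncard := by
  have h1 : frontier P ∩ Lat2 = (P ∩ Lat2) \ (interior P ∩ Lat2) := by
    rw [hP.cpt.isClosed.frontier_eq]
    ext z; simp only [Set.mem_inter_iff, Set.mem_sdiff]; tauto
  have hsub : interior P ∩ Lat2 ⊆ P ∩ Lat2 := Set.inter_subset_inter_left _ interior_subset
  rw [h1, Set.ncard_sdiff hsub (hP.finite.subset hsub), Nat.cast_sub (Set.ncard_le_ncard hsub hP.finite)]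

theorem caseA {P : Set E2} (hP : LP P)
    (hA : ∀ v ∈ Set.extremePoints ℝ P, (interior (Pv P v)).Nonempty) : 0 < deltaP P := by
  classical
  have hEf : (Set.extremePoints ℝ P).Finite := hP.finite.subset hP.ext_sub
  have hIf : (interior P ∩ Lat2).Finite := hP.finite.subset (Set.inter_subset_inter_left _ interior_subset)
  set X := hEf.toFinset with hX
  set I := hIf.toFinset with hI
  have hIcard : (interior P ∩ Lat2).ncard = I.card := Set.ncard_eq_toFinset_card _ hIf
  have hpick := pick hP
  have hfr := frontier_card hP
  -- per-vertex estimate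
  have hvert : ∀ v ∈ X, (1 : ℝ) - ((I.filter fun x => x ∉ interior (Pv P v)).card : ℝ) ≤ 2 - RSV (coneAt P v) := by
    intro v hv
    have hv : v ∈ Set.extremePoints ℝ P := by simpa [hX] using hv
    have h1 := RSV_le hP hv
    have h2 := pick (hP.Pv_LP hv (hA v hv))
    rw [hP.Pv_lat hv] at h2
    have h3 : (((P ∩ Lat2) \ {v}).ncard : ℝ) = (P ∩ Lat2).ncard - 1 := by
      have := Set.ncard_sdiff_singleton_add_one (hP.ext_sub hv) hP.finite
      have : (((P ∩ Lat2) \ {v}).ncard : ℝ) + 1 = (P ∩ Lat2).ncard := by exact_mod_cast this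
      linarith
    have h4 : ((interior (Pv P v) ∩ Lat2).ncard : ℝ) = I.card - ((I.filter fun x => x ∉ interior (Pv P v)).card : ℝ) := by
      have e : interior (Pv P v) ∩ Lat2 = ((I.filter fun x => x ∈ interior (Pv P v)) : Finset E2) := by
        ext z
        simp only [Finset.coe_filter, hI, Set.Finite.mem_toFinset, Set.mem_ofPred_eq, Set.mem_inter_iff]
        constructor
        · rintro ⟨a, b⟩; exact ⟨⟨interior_mono (hP.Pv_sub v) a, b⟩, a⟩
        · rintro ⟨⟨a, b⟩, c⟩; exact ⟨c, b⟩
      rw [e, Set.ncard_coe_finset]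
      have := Finset.card_filter_add_card_filter_not (s := I) (fun x => x ∈ interior (Pv P v))
      have : ((I.filter fun x => x ∈ interior (Pv P v)).card : ℝ) + (I.filter fun x => x ∉ interior (Pv P v)).card = I.card := by
        exact_mod_cast this
      linarith
    rw [hIcard] at hpick
    linarith
  -- double counting
  have hdc : ∑ v ∈ X, (I.filter fun x => x ∉ interior (Pv P v)).card ≤ I.card * 4 := by
    have := Finset.sum_card_bipartiteAbove_eq_sum_card_bipartiteBelow (s := X) (t := I)
      (fun v x => x ∉ interior (Pv P v))
    simp only [Finset.bipartiteAbove, Finset.bipartiteBelow] at this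
    rw [this]
    refine Finset.sum_le_card_nsmul _ _ _ (fun x hx => ?_)
    have hx : x ∈ interior P ∩ Lat2 := by simpa [hI] using hx
    have hf : ∀ v ∈ X.filter (fun v => x ∉ interior (Pv P v)), ∃ f : E2 →L[ℝ] ℝ, f ≠ 0 ∧ ∀ p ∈ Pv P v, f p ≤ f x := by
      intro v hv
      simp only [Finset.mem_filter, hX, Set.Finite.mem_toFinset] at hv
      exact support_fn (convex_convexHull ℝ _) (hA v hv.1) hv.2
    choose! f hf0 hf using hf
    refine obtuse (fun v => v - x) f ?_ ?_
    · intro v hv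
      by_contra hc
      push Not at hc
      rw [map_sub] at hc
      apply hf0 v hv
      refine no_int_max hx.1 (fun p hp => ?_)
      have : P ⊆ {p | f v p ≤ f v x} := by
        rw [← hP.eq]
        refine convexHull_min ?_ (convex_halfSpace_le (f v).toLinearMap.isLinear _)
        intro s hs
        by_cases hsv : s = v
        · subst hsv; change f s s ≤ f s x; linarith
        · exact hf v hv s (subset_convexHull ℝ _ ⟨hs, hsv⟩)
      exact this hp
    · intro v hv u hu huv
      have hu' : u ∈ Set.extremePoints ℝ P := by
        simp only [Finset.mem_filter, hX, Set.Finite.mem_toFinset] at hu; exact hu.1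
      have := hf v hv u (subset_convexHull ℝ _ ⟨hP.ext_sub hu', huv⟩)
      rw [map_sub]; linarith
  have hdc' : ∑ v ∈ X, ((I.filter fun x => x ∉ interior (Pv P v)).card : ℝ) ≤ I.card * 4 := by
    exact_mod_cast hdc
  obtain ⟨a, ha, b, hb, c, hc, hD⟩ := hP.ext_triple
  have hba : b ≠ a := by rintro rfl; simp [dt] at hD
  have hca : c ≠ a := by rintro rfl; simp [dt] at hD
  have hbc : b ≠ c := by rintro rfl; apply hD; simp [dt]; ring
  have hX3 : 3 ≤ X.card := by
    have : ({a, b, c} : Finset E2) ⊆ X := by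
      intro z hz
      simp only [Finset.mem_insert, Finset.mem_singleton] at hz
      rw [hX, Set.Finite.mem_toFinset]
      rcases hz with rfl | rfl | rfl <;> assumption
    have h3 := Finset.card_le_card this
    rwa [Finset.card_eq_three.2 ⟨a, b, c, hba.symm, hca.symm, hbc, rfl⟩] at h3
  have hS4 : 4 ≤ (P ∩ Lat2).ncard := by
    obtain ⟨a', ha', b', hb', c', hc', hD'⟩ := (hP.Pv_LP ha (hA a ha)).ext_triple
    have ha' := (hP.Pv_LP ha (hA a ha)).ext_sub ha'
    have hb' := (hP.Pv_LP ha (hA a ha)).ext_sub hb'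
    have hc' := (hP.Pv_LP ha (hA a ha)).ext_sub hc'
    rw [hP.Pv_lat ha] at ha' hb' hc'
    have hba : b' ≠ a' := by rintro rfl; simp [dt] at hD'
    have hca : c' ≠ a' := by rintro rfl; simp [dt] at hD'
    have hbc : b' ≠ c' := by rintro rfl; apply hD'; simp [dt]; ring
    have hsub : ({a', b', c'} : Set E2) ⊆ (P ∩ Lat2) \ {a} := by
      rintro z (rfl | rfl | rfl) <;> assumption
    have h3 := Set.ncard_le_ncard hsub (hP.finite.subset Set.sdiff_subset)
    rw [Set.ncard_eq_three.2 ⟨a', b', c', hba.symm, hca.symm, hbc, rfl⟩] at h3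
    have := Set.ncard_sdiff_singleton_add_one (hP.ext_sub ha) hP.finite
    omega
  have hsum := Finset.sum_le_sum hvert
  rw [Finset.sum_sub_distrib, Finset.sum_const, nsmul_eq_mul, mul_one] at hsum
  unfold deltaP
  rw [finsum_mem_eq_finite_toFinset_sum _ hEf, hfr]
  rw [hIcard] at hpick ⊢
  have hX3' : (3 : ℝ) ≤ X.card := by exact_mod_cast hX3
  have hS4' : (4 : ℝ) ≤ (P ∩ Lat2).ncard := by exact_mod_cast hS4
  have : (0 : ℝ) ≤ I.card := by positivity
  linarith

lemma dt_int {u w : E2} (hu : u ∈ Lat2) (hw : w ∈ Lat2) : ∃ n : ℤ, dt u w = n := by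
  obtain ⟨a, ha⟩ := hu 0
  obtain ⟨b, hb⟩ := hu 1
  obtain ⟨c, hc⟩ := hw 0
  obtain ⟨d, hd⟩ := hw 1
  exact ⟨a * d - b * c, by simp [dt, ha, hb, hc, hd]⟩

lemma dt_smul_left (t : ℝ) (u w : E2) : dt (t • u) w = t * dt u w := by
  simp [dt]; ring

lemma dt_smul_right (t : ℝ) (u w : E2) : dt u (t • w) = t * dt u w := by
  simp [dt]; ring

lemma dt_comb_left (a b : ℝ) (u w : E2) : dt (a • u + b • w) w = a * dt u w := by
  simp [dt]; ring

lemma dt_comb_right (a b : ℝ) (u w : E2) : dt u (a • u + b • w) = b * dt u w := by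
  simp [dt]; ring

lemma coneTwo_smul {t : ℝ} (ht : 0 < t) (u w : E2) : coneTwo (t • u) w = coneTwo u w := by
  ext x
  constructor
  · rintro ⟨a, b, ha, hb, rfl⟩
    exact ⟨a * t, b, by positivity, hb, by rw [smul_smul]⟩
  · rintro ⟨a, b, ha, hb, rfl⟩
    exact ⟨a / t, b, by positivity, hb, by rw [smul_smul, div_mul_cancel₀ _ ht.ne']⟩

lemma coneAt_tri (a b c : E2) :
    coneAt (convexHull ℝ ({a, b, c} : Set E2)) a = coneTwo (b - a) (c - a) := by
  ext x
  constructor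
  · rintro ⟨t, ht, p, hp, rfl⟩
    obtain ⟨s, r, hs, hr, -, rfl⟩ := mem_tri.1 hp
    exact ⟨t * s, t * r, by positivity, by positivity, by module⟩
  · rintro ⟨s, r, hs, hr, rfl⟩
    have hd : 0 < s + r + 1 := by positivity
    refine ⟨s + r + 1, hd.le, a + (s / (s + r + 1)) • (b - a) + (r / (s + r + 1)) • (c - a),
      mem_tri.2 ⟨_, _, by positivity, by positivity, ?_, rfl⟩, ?_⟩
    · rw [← add_div, div_le_one hd]; linarith
    · have e1 : (s + r + 1) * (s / (s + r + 1)) = s := by field_simp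
      have e2 : (s + r + 1) * (r / (s + r + 1)) = r := by field_simp
      generalize hy : s / (s + r + 1) = y at *
      generalize hz : r / (s + r + 1) = z at *
      have : (s + r + 1) • (a + y • (b - a) + z • (c - a) - a) =
          ((s + r + 1) * y) • (b - a) + ((s + r + 1) * z) • (c - a) := by module
      rw [this, e1, e2]

lemma RSV_cone {u w : E2} (hu : u ∈ Lat2) (hw : w ∈ Lat2) (hD : dt u w ≠ 0)
    (h : ∀ a b : ℝ, 0 ≤ a → 0 ≤ b → 0 < a + b → a • u + b • w ∈ Lat2 → 1 ≤ a + b) :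
    RSV (coneTwo u w) = |dt u w| := by
  have hne : ∀ x ∈ coneTwo u w, x ≠ 0 → 0 < dt x w / dt u w + dt u x / dt u w := by
    rintro x ⟨a, b, ha, hb, rfl⟩ hx
    rw [dt_comb_left, dt_comb_right, mul_div_cancel_right₀ _ hD, mul_div_cancel_right₀ _ hD]
    rcases (add_nonneg ha hb).eq_or_lt with h0 | h0
    · exfalso; apply hx
      have h1 : a = 0 := by linarith
      have h2 : b = 0 := by linarith
      simp [h1, h2]
    · exact h0
  have hu0 : u ≠ 0 := by rintro rfl; simp [dt] at hD
  have hw0 : w ≠ 0 := by rintro rfl; simp [dt] at hD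
  have hsc : ∀ x ∈ coneTwo u w, ∀ n : ℕ, (n : ℝ) • x ∈ coneTwo u w := by
    rintro x ⟨a, b, ha, hb, rfl⟩ n
    exact ⟨n * a, n * b, by positivity, by positivity, by module⟩
  have huK : u ∈ convexHull ℝ ((coneTwo u w \ {0}) ∩ Lat2) :=
    subset_convexHull ℝ _ ⟨⟨⟨1, 0, by simp, by simp, by simp⟩, hu0⟩, hu⟩
  have hwK : w ∈ convexHull ℝ ((coneTwo u w \ {0}) ∩ Lat2) :=
    subset_convexHull ℝ _ ⟨⟨⟨0, 1, by simp, by simp, by simp⟩, hw0⟩, hw⟩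
  have hK1 : ∀ x ∈ convexHull ℝ ((coneTwo u w \ {0}) ∩ Lat2), 1 ≤ dt x w / dt u w + dt u x / dt u w := by
    have hc : Convex ℝ {x : E2 | 1 ≤ dt x w / dt u w + dt u x / dt u w} := by
      intro p hp q hq a b ha hb hab
      have hp : 1 ≤ dt p w / dt u w + dt u p / dt u w := hp
      have hq : 1 ≤ dt q w / dt u w + dt u q / dt u w := hq
      change 1 ≤ dt (a • p + b • q) w / dt u w + dt u (a • p + b • q) / dt u w
      have : dt (a • p + b • q) w / dt u w + dt u (a • p + b • q) / dt u w
        = a * (dt p w / dt u w + dt u p / dt u w) + b * (dt q w / dt u w + dt u q / dt u w) := by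
        simp only [dt, Pi.add_apply, Pi.smul_apply, smul_eq_mul]; ring
      rw [this]; nlinarith
    intro x hx
    refine convexHull_min ?_ hc hx
    rintro z ⟨⟨hz, hz0⟩, hzL⟩
    have h0 := hne z hz hz0
    change 1 ≤ dt z w / dt u w + dt u z / dt u w
    obtain ⟨a, b, ha, hb, rfl⟩ := hz
    rw [dt_comb_left, dt_comb_right, mul_div_cancel_right₀ _ hD, mul_div_cancel_right₀ _ hD] at *
    exact h a b ha hb h0 hzL
  unfold RSV
  rw [tri_vol (p := 0) (u := u) (w := w), ENNReal.toReal_ofReal (by positivity)]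
  · ring
  · intro a b ha hb hab
    rw [zero_add]
    refine ⟨⟨a, b, ha.le, hb.le, rfl⟩, fun hmem => ?_⟩
    have := hK1 _ hmem
    rw [dt_comb_left, dt_comb_right, mul_div_cancel_right₀ _ hD, mul_div_cancel_right₀ _ hD] at this
    linarith
  · rintro x ⟨⟨a, b, ha, hb, rfl⟩, hxK⟩
    refine ⟨a, b, ha, hb, ?_, by rw [zero_add]⟩
    by_contra! hlt
    apply hxK
    have hd : 0 < a + b := by linarith
    have hm := convex_convexHull ℝ ((coneTwo u w \ {0}) ∩ Lat2) huK hwK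
      (a := a / (a + b)) (b := b / (a + b)) (by positivity) (by positivity) (by field_simp)
    have := K_scale hsc hm hlt.le
    convert this using 1
    rw [smul_add, smul_smul, smul_smul, mul_div_cancel₀ _ hd.ne', mul_div_cancel₀ _ hd.ne']

lemma tri_LP {a b c : E2} (ha : a ∈ Lat2) (hb : b ∈ Lat2) (hc : c ∈ Lat2)
    (hD : dt (b - a) (c - a) ≠ 0) : LP (convexHull ℝ ({a, b, c} : Set E2)) := by
  have hsub : ({a, b, c} : Set E2) ⊆ Lat2 := by
    rintro x (rfl | rfl | rfl) <;> assumption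
  refine ⟨Set.Finite.isCompact_convexHull ℝ (Set.toFinite _), convex_convexHull ℝ _,
    convexHull_mono (fun x hx => ⟨subset_convexHull ℝ _ hx, hsub hx⟩), ?_⟩
  exact ⟨_, tri_interior (convex_convexHull ℝ _) (subset_convexHull ℝ _ (by simp)) (subset_convexHull ℝ _ (by simp))
    (subset_convexHull ℝ _ (by simp)) hD (s := 1/3) (t := 1/3) (by norm_num) (by norm_num) (by norm_num)⟩

lemma tri_ext {a b c : E2} (ha : a ∈ Lat2) (hb : b ∈ Lat2) (hc : c ∈ Lat2)
    (hD : dt (b - a) (c - a) ≠ 0) :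
    Set.extremePoints ℝ (convexHull ℝ ({a, b, c} : Set E2)) = {a, b, c} := by
  apply Set.Subset.antisymm extremePoints_convexHull_subset
  obtain ⟨x, hx, y, hy, z, hz, h⟩ := (tri_LP ha hb hc hD).ext_triple
  have hxy : x ≠ y := by rintro rfl; simp [dt] at h
  have hxz : x ≠ z := by rintro rfl; simp [dt] at h
  have hyz : y ≠ z := by
    rintro rfl; apply h; simp [dt]; ring
  have hx' := extremePoints_convexHull_subset hx
  have hy' := extremePoints_convexHull_subset hy
  have hz' := extremePoints_convexHull_subset hz
  simp only [Set.mem_insert_iff, Set.mem_singleton_iff] at hx' hy' hz'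
  intro p hp
  simp only [Set.mem_insert_iff, Set.mem_singleton_iff] at hp
  have : p = x ∨ p = y ∨ p = z := by grind
  rcases this with rfl | rfl | rfl <;> assumption

theorem delta_tri1 {q e w : E2} {l : ℕ} (hl : 0 < l) (hq : q ∈ Lat2) (he : e ∈ Lat2) (hw : w ∈ Lat2)
    (hD : dt e w = 1) : deltaP (convexHull ℝ ({q, q + (l : ℝ) • e, q + w} : Set E2)) = 0 := by
  have hl' : (0 : ℝ) < l := by exact_mod_cast hl
  have hle : (l : ℝ) • e ∈ Lat2 := by simpa using lat_zsmul he l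
  have hb := lat_add hq hle
  have hc := lat_add hq hw
  have hdet : dt (q + (l : ℝ) • e - q) (q + w - q) = l := by
    rw [add_sub_cancel_left, add_sub_cancel_left, dt_smul_left, hD, mul_one]
  have hdet0 : dt (q + (l : ℝ) • e - q) (q + w - q) ≠ 0 := by rw [hdet]; exact hl'.ne'
  have hLP := tri_LP hq hb hc hdet0
  have hvol : 2 * (volume (convexHull ℝ ({q, q + (l : ℝ) • e, q + w} : Set E2))).toReal = l := by
    rw [tri_volume, hdet, abs_of_pos hl', ENNReal.toReal_ofReal (by positivity)]; ring
  have h_intr : interior (convexHull ℝ ({q, q + (l : ℝ) • e, q + w} : Set E2)) ∩ Lat2 = ∅ := by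
    rw [Set.eq_empty_iff_forall_notMem]
    rintro x ⟨hx, hxL⟩
    obtain ⟨h1, h2, h3⟩ := tri_int_pos (by rw [hdet]; exact hl') hx
    rw [hdet] at h3
    have hx2 : q + (l : ℝ) • e - q = (l : ℝ) • e := add_sub_cancel_left _ _
    rw [hx2, dt_smul_left] at h2 h3
    rw [add_sub_cancel_left] at h1 h3
    obtain ⟨n, hn⟩ := dt_int he (lat_sub hxL hq)
    rw [hn] at h2 h3
    have n0 : (0 : ℝ) < n := pos_of_mul_pos_right h2 hl'.le
    have n1 : (n : ℝ) < 1 := by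
      by_contra! hc; nlinarith
    have : 0 < n := by exact_mod_cast n0
    have : n < 1 := by exact_mod_cast n1
    omega
  have hp := pick hLP
  have hf := frontier_card hLP
  rw [h_intr, Set.ncard_empty] at hp hf
  -- cones
  have e0 : e ≠ 0 := by rintro rfl; simp [dt] at hD
  have R1 : RSV (coneAt (convexHull ℝ ({q, q + (l : ℝ) • e, q + w} : Set E2)) q) = 1 := by
    rw [coneAt_tri, add_sub_cancel_left, add_sub_cancel_left, coneTwo_smul hl', RSV_cone he hw (by rw [hD]; simp), hD, abs_one]
    intro a b ha hb hab hL
    obtain ⟨n, hn⟩ := dt_int hL hw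
    obtain ⟨m, hm⟩ := dt_int he hL
    rw [dt_comb_left, hD, mul_one] at hn
    rw [dt_comb_right, hD, mul_one] at hm
    rw [hn, hm] at hab ⊢
    have : 0 < n + m := by exact_mod_cast hab
    exact_mod_cast this
  have R2 : RSV (coneAt (convexHull ℝ ({q, q + (l : ℝ) • e, q + w} : Set E2)) (q + (l : ℝ) • e)) = 1 := by
    have hset : ({q, q + (l : ℝ) • e, q + w} : Set E2) = {q + (l : ℝ) • e, q, q + w} := Set.insert_comm _ _ _
    have h1 : q - (q + (l : ℝ) • e) = (l : ℝ) • (-e) := by module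
    have h2 : q + w - (q + (l : ℝ) • e) = w - (l : ℝ) • e := by module
    have hd : dt (-e) (w - (l : ℝ) • e) = -1 := by
      rw [← hD]; simp [dt]; ring
    have hw' := lat_sub hw hle
    have he' := lat_neg he
    rw [hset, coneAt_tri, h1, h2, coneTwo_smul hl', RSV_cone he' hw' (by rw [hd]; simp), hd]
    · simp
    intro a b ha hb hab hL
    obtain ⟨n, hn⟩ := dt_int hL hw'
    obtain ⟨m, hm⟩ := dt_int he' hL
    rw [dt_comb_left, hd] at hn
    rw [dt_comb_right, hd] at hm
    have ha' : a = ((-n : ℤ) : ℝ) := by push_cast; linarith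
    have hb' : b = ((-m : ℤ) : ℝ) := by push_cast; linarith
    rw [ha', hb'] at hab ⊢
    have : 0 < -n + -m := by exact_mod_cast hab
    exact_mod_cast this
  have R3 : RSV (coneAt (convexHull ℝ ({q, q + (l : ℝ) • e, q + w} : Set E2)) (q + w)) = l := by
    have hset : ({q, q + (l : ℝ) • e, q + w} : Set E2) = {q + w, q, q + (l : ℝ) • e} := by
      rw [Set.insert_comm (q + w), Set.pair_comm]
    have h1 : q - (q + w) = -w := by module
    have h2 : q + (l : ℝ) • e - (q + w) = (l : ℝ) • e - w := by module
    have hd : dt (-w) ((l : ℝ) • e - w) = l := by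
      have : dt (-w) ((l : ℝ) • e - w) = l * dt e w := by simp [dt]; ring
      rw [this, hD, mul_one]
    rw [hset, coneAt_tri, h1, h2, RSV_cone (lat_neg hw) (lat_sub hle hw) (by rw [hd]; exact hl'.ne'), hd, abs_of_pos hl']
    intro a b ha hb hab hL
    obtain ⟨n, hn⟩ := dt_int he hL
    have : dt e (a • (-w) + b • ((l : ℝ) • e - w)) = - (a + b) * dt e w := by simp [dt]; ring
    rw [this, hD, mul_one] at hn
    have hs : a + b = ((-n : ℤ) : ℝ) := by push_cast; linarith
    rw [hs] at hab ⊢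
    have : 0 < -n := by exact_mod_cast hab
    exact_mod_cast this
  unfold deltaP
  rw [tri_ext hq hb hc hdet0, hvol, hf]
  have n1 : q ≠ q + (l : ℝ) • e := by
    intro h
    have : (l : ℝ) • e = 0 := by simpa using h
    simp [hl'.ne', e0] at this
  have n2 : q ≠ q + w := by
    intro h
    have : w = 0 := by simpa using h
    rw [this] at hD; simp [dt] at hD
  have n3 : q + (l : ℝ) • e ≠ q + w := by
    intro h
    rw [h] at hdet
    apply hl'.ne
    rw [← hdet]; simp [dt]; ring
  rw [finsum_mem_insert _ (by simp only [Set.mem_insert_iff, Set.mem_singleton_iff]; tauto) (Set.toFinite _),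
    finsum_mem_insert _ (by simpa using n3) (Set.toFinite _), finsum_mem_singleton, R1, R2, R3]
  rw [hvol] at hp
  push_cast at hp ⊢
  linarith

theorem delta_tri {q e w : E2} {l : ℕ} (hl : 0 < l) (hq : q ∈ Lat2) (he : e ∈ Lat2) (hw : w ∈ Lat2)
    (hD : |dt e w| = 1) : deltaP (convexHull ℝ ({q, q + (l : ℝ) • e, q + w} : Set E2)) = 0 := by
  rcases eq_or_eq_neg_of_abs_eq hD with h | h
  · exact delta_tri1 hl hq he hw h
  · have hle : (l : ℝ) • e ∈ Lat2 := by simpa using lat_zsmul he l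
    have := delta_tri1 hl (lat_add hq hle) (lat_neg he) (lat_sub hw hle)
      (by have : dt (-e) (w - (l : ℝ) • e) = - dt e w := by simp [dt]; ring
          rw [this, h, neg_neg])
    have e1 : q + (l : ℝ) • e + (l : ℝ) • (-e) = q := by module
    have e2 : q + (l : ℝ) • e + (w - (l : ℝ) • e) = q + w := by module
    rwa [e1, e2, Set.insert_comm] at this

lemma parallel {e x : E2} (he : e ≠ 0) (h : dt e x = 0) : ∃ m : ℝ, x = m • e := by
  have hs : 0 < e 0 ^ 2 + e 1 ^ 2 := by
    by_contra! hc
    apply he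
    have h0 : e 0 = 0 := by nlinarith [sq_nonneg (e 0), sq_nonneg (e 1)]
    have h1 : e 1 = 0 := by nlinarith [sq_nonneg (e 0), sq_nonneg (e 1)]
    ext i; fin_cases i <;> simp [h0, h1]
  have h' : e 0 * x 1 - e 1 * x 0 = 0 := h
  refine ⟨(e 0 * x 0 + e 1 * x 1) / (e 0 ^ 2 + e 1 ^ 2), ?_⟩
  ext i
  fin_cases i <;> simp only [Pi.smul_apply, smul_eq_mul, Fin.zero_eta, Fin.mk_one] <;>
    rw [div_mul_eq_mul_div, eq_div_iff hs.ne']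
  · linear_combination (-e 1) * h'
  · linear_combination (e 0) * h'

theorem caseB {P : Set E2} (hP : LP P) {v : E2} (hv : v ∈ Set.extremePoints ℝ P)
    (hB : ¬ (interior (Pv P v)).Nonempty) :
    ∃ l : ℕ, 0 < l ∧ ∃ q ∈ Lat2, ∃ e ∈ Lat2, ∃ w ∈ Lat2, |dt e w| = 1 ∧
      P = convexHull ℝ ({q, q + (l : ℝ) • e, q + w} : Set E2) := by
  have hvS := hP.ext_sub hv
  have hCf : ((P ∩ Lat2) \ {v}).Finite := hP.finite.subset Set.sdiff_subset
  have hcol : ∀ a ∈ (P ∩ Lat2) \ {v}, ∀ b ∈ (P ∩ Lat2) \ {v}, ∀ c ∈ (P ∩ Lat2) \ {v}, dt (b - a) (c - a) = 0 := by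
    intro a ha b hb c hc
    by_contra hD
    exact hB ⟨_, tri_interior (convex_convexHull ℝ _) (subset_convexHull ℝ _ ha) (subset_convexHull ℝ _ hb)
      (subset_convexHull ℝ _ hc) hD (s := 1/3) (t := 1/3) (by norm_num) (by norm_num) (by norm_num)⟩
  -- two distinct points
  obtain ⟨p, hp, r, hr, hpr⟩ : ∃ p ∈ (P ∩ Lat2) \ {v}, ∃ r ∈ (P ∩ Lat2) \ {v}, p ≠ r := by
    obtain ⟨x, hx, y, hy, z, hz, h⟩ := hP.ext_triple
    have hxy : x ≠ y := by rintro rfl; simp [dt] at h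
    have hxz : x ≠ z := by rintro rfl; simp [dt] at h
    have hyz : y ≠ z := by
      rintro rfl; apply h; simp [dt]; ring
    have hx := hP.ext_sub hx
    have hy := hP.ext_sub hy
    have hz := hP.ext_sub hz
    by_cases h1 : x = v
    · exact ⟨y, ⟨hy, fun h => hxy (h1.trans h.symm)⟩, z, ⟨hz, fun h => hxz (h1.trans h.symm)⟩, hyz⟩
    · by_cases h2 : y = v
      · exact ⟨x, ⟨hx, h1⟩, z, ⟨hz, fun h => hyz (h2.trans h.symm)⟩, hxz⟩
      · exact ⟨x, ⟨hx, h1⟩, y, ⟨hy, h2⟩, hxy⟩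
  set C := (P ∩ Lat2) \ {v} with hC
  have hd0 : r - p ≠ 0 := fun h => hpr (sub_eq_zero.1 h).symm
  set g : E2 → ℝ := fun x => (r - p) 0 * x 0 + (r - p) 1 * x 1 with hg
  have gsub : ∀ x y, g (x - y) = g x - g y := by
    intro x y; simp only [hg, Pi.sub_apply]; ring
  have gsmul : ∀ (m : ℝ) x, g (m • x) = m * g x := by
    intro m x; simp only [hg, Pi.smul_apply, smul_eq_mul]; ring
  have gd : 0 < g (r - p) := by
    by_contra! hc
    apply hd0
    have hc' : (r - p) 0 * (r - p) 0 + (r - p) 1 * (r - p) 1 ≤ 0 := hc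
    have h0 : (r - p) 0 = 0 := by nlinarith [sq_nonneg ((r - p) 0), sq_nonneg ((r - p) 1)]
    have h1 : (r - p) 1 = 0 := by nlinarith [sq_nonneg ((r - p) 0), sq_nonneg ((r - p) 1)]
    ext i; fin_cases i
    · exact h0
    · exact h1
  have ginj : ∀ x ∈ C, ∀ y ∈ C, g x = g y → x = y := by
    intro x hx y hy hxy
    obtain ⟨a, ha⟩ := parallel hd0 (hcol p hp r hr x hx)
    obtain ⟨b, hb⟩ := parallel hd0 (hcol p hp r hr y hy)
    have h1 : g (x - p) = g (y - p) := by rw [gsub, gsub, hxy]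
    rw [ha, hb, gsmul, gsmul] at h1
    have : a = b := mul_right_cancel₀ gd.ne' h1
    rw [this, ← hb] at ha
    exact sub_left_injective ha
  obtain ⟨q0, hq0, hmin⟩ := Set.exists_min_image C g hCf ⟨p, hp⟩
  have hC1 : (C \ {q0}).Nonempty := by
    by_cases h : p = q0
    · exact ⟨r, hr, fun h' => hpr (h.trans h'.symm)⟩
    · exact ⟨p, hp, h⟩
  obtain ⟨q1, hq1, hmin1⟩ := Set.exists_min_image (C \ {q0}) g (hCf.subset Set.sdiff_subset) hC1
  obtain ⟨q2, hq2, hmax⟩ := Set.exists_max_image C g hCf ⟨p, hp⟩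
  set e := q1 - q0 with he
  set w := v - q0 with hw
  have ge : 0 < g e := by
    rw [he, gsub, sub_pos]
    refine lt_of_le_of_ne (hmin q1 hq1.1) fun h => hq1.2 (ginj _ hq1.1 _ hq0 h.symm)
  have he0 : e ≠ 0 := by intro h; rw [h] at ge; simp [hg] at ge
  have heL : e ∈ Lat2 := lat_sub hq1.1.1.2 hq0.1.2
  have hwL : w ∈ Lat2 := lat_sub hvS.2 hq0.1.2
  have hpar : ∀ s ∈ C, ∃ m : ℝ, s = q0 + m • e ∧ 0 ≤ m ∧ (m = 0 ∨ 1 ≤ m) := by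
    intro s hs
    obtain ⟨m, hm⟩ := parallel he0 (hcol q0 hq0 q1 hq1.1 s hs)
    have hgm : g s - g q0 = m * g e := by rw [← gsub, hm, gsmul]
    refine ⟨m, by rw [← hm]; abel, ?_, ?_⟩
    · have := hmin s hs
      by_contra! hc; nlinarith
    · by_cases h : s = q0
      · left
        rw [h, sub_self] at hgm
        rcases mul_eq_zero.1 hgm.symm with h | h
        · exact h
        · exact absurd h ge.ne'
      · right
        have h1 := hmin1 s ⟨hs, h⟩
        have h2 : g e = g q1 - g q0 := gsub _ _
        by_contra! hc; nlinarith
  have hDne : dt e w ≠ 0 := by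
    intro hD
    obtain ⟨x, hx, y, hy, z, hz, h⟩ := hP.ext_triple
    have hall : ∀ s ∈ P ∩ Lat2, ∃ m : ℝ, s = q0 + m • e := by
      intro s hs
      by_cases hsv : s = v
      · obtain ⟨m, hm⟩ := parallel he0 hD
        exact ⟨m, by rw [hsv, ← hm, hw]; abel⟩
      · obtain ⟨m, hm, -⟩ := hpar s ⟨hs, hsv⟩
        exact ⟨m, hm⟩
    obtain ⟨a, rfl⟩ := hall x (hP.ext_sub hx)
    obtain ⟨b, rfl⟩ := hall y (hP.ext_sub hy)
    obtain ⟨c, rfl⟩ := hall z (hP.ext_sub hz)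
    apply h
    simp only [dt, Pi.sub_apply, Pi.add_apply, Pi.smul_apply, smul_eq_mul]; ring
  have hsubP : convexHull ℝ ({q0, q1, v} : Set E2) ⊆ P := by
    apply convexHull_min _ hP.cvx
    rintro x (rfl | rfl | rfl)
    exacts [hq0.1.1, hq1.1.1.1, hvS.1]
  have hTL := tri_LP hq0.1.2 hq1.1.1.2 hvS.2 hDne
  have hTe := tri_ext hq0.1.2 hq1.1.1.2 hvS.2 hDne
  have hlat : convexHull ℝ ({q0, q1, v} : Set E2) ∩ Lat2 = {q0, q1, v} := by
    apply Set.Subset.antisymm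
    · rintro x ⟨hx, hxL⟩
      by_cases hxv : x = v
      · simp [hxv]
      obtain ⟨m, hm, hm0, hm1⟩ := hpar x ⟨⟨hsubP hx, hxL⟩, hxv⟩
      obtain ⟨s, t, hs, ht, hst, hxe⟩ := mem_tri.1 hx
      have hh : m • e = s • e + t • w := by
        have : q0 + m • e = q0 + (s • e + t • w) := by rw [← hm, hxe]; abel
        exact add_left_cancel this
      have h1 := congrArg (dt e) hh
      rw [dt_comb_right] at h1
      have h1' : dt e (m • e) = 0 := by simp [dt]; ring
      rw [h1'] at h1
      have ht0 : t = 0 := by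
        rcases mul_eq_zero.1 h1.symm with h | h
        · exact h
        · exact absurd h hDne
      have h2 := congrArg (fun z => dt z w) hh
      simp only [dt_comb_left, dt_smul_left] at h2
      have hms : m = s := mul_right_cancel₀ hDne h2
      rcases hm1 with h | h
      · left; rw [hm, h]; simp
      · right; left
        have : m = 1 := by linarith
        rw [hm, this, he]; simp
    · rintro x hx
      refine ⟨subset_convexHull ℝ _ hx, ?_⟩
      rcases hx with rfl | rfl | rfl
      exacts [hq0.1.2, hq1.1.1.2, hvS.2]
  have hintr : interior (convexHull ℝ ({q0, q1, v} : Set E2)) ∩ Lat2 = ∅ := by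
    rw [Set.eq_empty_iff_forall_notMem]
    rintro x ⟨hx, hxL⟩
    have : x ∈ convexHull ℝ ({q0, q1, v} : Set E2) ∩ Lat2 := ⟨interior_subset hx, hxL⟩
    rw [hlat, ← hTe] at this
    exact ext_not_int this hx
  have hcard : ({q0, q1, v} : Set E2).ncard = 3 := by
    rw [Set.ncard_eq_three]
    exact ⟨q0, q1, v, fun h => hq1.2 h.symm, hq0.2, hq1.1.2, rfl⟩
  have hpk := pick hTL
  rw [hlat, hintr, hcard, Set.ncard_empty, tri_volume, ENNReal.toReal_ofReal (by positivity)] at hpk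
  have habs : |dt e w| = 1 := by
    have : 2 * (|dt e w| / 2) = (3 : ℕ) + (0 : ℕ) - (2 : ℝ) := hpk
    push_cast at this; linarith
  have hpari : ∀ s ∈ C, ∃ m : ℤ, s = q0 + (m : ℝ) • e ∧ 0 ≤ m := by
    intro s hs
    obtain ⟨m, hm, hm0, -⟩ := hpar s hs
    obtain ⟨n, hn⟩ := dt_int (lat_sub hs.1.2 hq0.1.2) hwL
    have : s - q0 = m • e := by rw [hm]; abel
    rw [this, dt_smul_left] at hn
    have : ∃ k : ℤ, m = k := by
      rcases eq_or_eq_neg_of_abs_eq habs with h | h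
      · rw [h] at hn; exact ⟨n, by linarith⟩
      · rw [h] at hn; exact ⟨-n, by push_cast; linarith⟩
    obtain ⟨k, rfl⟩ := this
    exact ⟨k, hm, by exact_mod_cast hm0⟩
  obtain ⟨L, hL, hL0⟩ := hpari q2 hq2
  have hle : ∀ s ∈ C, ∀ m : ℤ, s = q0 + (m : ℝ) • e → m ≤ L := by
    intro s hs m hm
    have h1 := hmax s hs
    have a1 : g s - g q0 = m * g e := by rw [← gsub, hm, add_sub_cancel_left, gsmul]
    have a2 : g q2 - g q0 = L * g e := by rw [← gsub, hL, add_sub_cancel_left, gsmul]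
    have : (m : ℝ) ≤ L := by
      by_contra! hc; nlinarith
    exact_mod_cast this
  have hL1 : 1 ≤ L := hle q1 hq1.1 1 (by rw [he]; simp)
  obtain ⟨l, rfl⟩ := Int.eq_ofNat_of_zero_le hL0
  have hl : 0 < l := by omega
  have hl' : (0 : ℝ) < l := by exact_mod_cast hl
  refine ⟨l, hl, q0, hq0.1.2, e, heL, w, hwL, habs, ?_⟩
  have hvw : q0 + w = v := by rw [hw]; abel
  have hL : q2 = q0 + (l : ℝ) • e := by simpa using hL
  apply Set.Subset.antisymm
  · refine hP.hull.trans (convexHull_min ?_ (convex_convexHull ℝ _))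
    intro s hs
    by_cases hsv : s = v
    · rw [hsv, hvw]; exact subset_convexHull ℝ _ (by simp)
    · obtain ⟨m, hm, hm0⟩ := hpari s ⟨hs, hsv⟩
      have hmL : m ≤ l := hle s ⟨hs, hsv⟩ m hm
      have h1 : (m : ℝ) ≤ l := by exact_mod_cast hmL
      have h0 : (0 : ℝ) ≤ m := by exact_mod_cast hm0
      refine mem_tri.2 ⟨m / l, 0, by positivity, le_rfl, ?_, ?_⟩
      · rw [add_zero, div_le_one hl']; exact h1
      · rw [add_sub_cancel_left, smul_smul, div_mul_cancel₀ _ hl'.ne', zero_smul, add_zero]; exact hm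
  · apply convexHull_min _ hP.cvx
    rintro x (rfl | rfl | rfl)
    · exact hq0.1.1
    · rw [← hL]; exact hq2.1.1
    · rw [hvw]; exact hvS.1

/-- the affine map of an integer matrix and an integer translation -/
noncomputable def affA (A : Matrix (Fin 2) (Fin 2) ℤ) (t : Fin 2 → ℤ) : E2 →ᵃ[ℝ] E2 :=
  (Matrix.mulVecLin (A.map (Int.cast : ℤ → ℝ))).toAffineMap + AffineMap.const ℝ E2 (fun i => (t i : ℝ))

lemma affA_eq (A : Matrix (Fin 2) (Fin 2) ℤ) (t : Fin 2 → ℤ) :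
    (fun x : Fin 2 → ℝ => fun i => (∑ j, (A i j : ℝ) * x j) + (t i : ℝ)) = affA A t := by
  funext x i
  fin_cases i <;> simp [affA]

lemma affA_tri (A : Matrix (Fin 2) (Fin 2) ℤ) (t : Fin 2 → ℤ) (a b c : E2) :
    (fun x : Fin 2 → ℝ => fun i => (∑ j, (A i j : ℝ) * x j) + (t i : ℝ)) '' convexHull ℝ ({a, b, c} : Set E2)
      = convexHull ℝ ({(fun i => (∑ j, (A i j : ℝ) * a j) + (t i : ℝ)),
        (fun i => (∑ j, (A i j : ℝ) * b j) + (t i : ℝ)), (fun i => (∑ j, (A i j : ℝ) * c j) + (t i : ℝ))} : Set E2) := by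
  rw [affA_eq, AffineMap.image_convexHull, ← affA_eq, Set.image_insert_eq, Set.image_insert_eq, Set.image_singleton]

lemma equiv_mp {P : Set E2} {l : ℕ} (A : Matrix (Fin 2) (Fin 2) ℤ) (t : Fin 2 → ℤ) (hA : IsUnit A.det)
    (h : (fun x : Fin 2 → ℝ => fun i => (∑ j, (A i j : ℝ) * x j) + (t i : ℝ)) '' P
            = convexHull ℝ ({![(0 : ℝ), 0], ![(l : ℝ), 0], ![(0 : ℝ), 1]} : Set (Fin 2 → ℝ))) :
    ∃ q ∈ Lat2, ∃ e ∈ Lat2, ∃ w ∈ Lat2, |dt e w| = 1 ∧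
      P = convexHull ℝ ({q, q + (l : ℝ) • e, q + w} : Set E2) := by
  obtain ⟨d, hd⟩ : ∃ d : ℤ, d = A.det := ⟨_, rfl⟩
  have hdd : d * d = 1 := by
    rw [← hd] at hA
    rcases Int.isUnit_iff.1 hA with h | h <;> rw [h] <;> rfl
  rw [Matrix.det_fin_two] at hd
  have hddR : (d : ℝ) * d = 1 := by exact_mod_cast hdd
  have hdR : (d : ℝ) = A 0 0 * A 1 1 - A 0 1 * A 1 0 := by exact_mod_cast hd
  have hdabs : |(d : ℝ)| = 1 := by
    have := abs_mul (d : ℝ) d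
    rw [hddR, abs_one] at this
    nlinarith [abs_nonneg (d : ℝ)]
  have heL : iot (d * A 1 1, - d * A 1 0) ∈ Lat2 := mem_lat_iff.2 ⟨_, rfl⟩
  have hwL : iot (- d * A 0 1, d * A 0 0) ∈ Lat2 := mem_lat_iff.2 ⟨_, rfl⟩
  refine ⟨iot (- (t 0 * (d * A 1 1) + t 1 * (- d * A 0 1)), - (t 0 * (- d * A 1 0) + t 1 * (d * A 0 0))),
    mem_lat_iff.2 ⟨_, rfl⟩, _, heL, _, hwL, ?_, ?_⟩
  · have : dt (iot (d * A 1 1, - d * A 1 0)) (iot (- d * A 0 1, d * A 0 0)) = d := by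
      simp only [dt, iot, Matrix.cons_val_zero, Matrix.cons_val_one]
      push_cast
      linear_combination (A 0 0 * A 1 1 - A 0 1 * A 1 0 : ℝ) * hddR - hdR
    rw [this, hdabs]
  · have hinj : Function.Injective (fun x : Fin 2 → ℝ => fun i => (∑ j, (A i j : ℝ) * x j) + (t i : ℝ)) := by
      intro x y hxy
      have h0 := congr_fun hxy 0
      have h1 := congr_fun hxy 1
      simp only [Fin.sum_univ_two] at h0 h1
      ext i
      fin_cases i
      · simp only [Fin.zero_eta]
        linear_combination (d * A 1 1 : ℝ) * h0 - (d * A 0 1 : ℝ) * h1 - (x 0 - y 0) * hddR + (x 0 - y 0) * d * hdR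
      · simp only [Fin.mk_one]
        linear_combination (d * A 0 0 : ℝ) * h1 - (d * A 1 0 : ℝ) * h0 - (x 1 - y 1) * hddR + (x 1 - y 1) * d * hdR
    apply Set.image_injective.2 hinj
    rw [h, affA_tri]
    congr 1
    have E1 : ∀ a b c a' b' c' : E2, a = a' → b = b' → c = c' → ({a, b, c} : Set E2) = {a', b', c'} := by
      rintro a b c _ _ _ rfl rfl rfl; rfl
    apply E1
    all_goals
      ext i
      fin_cases i <;> simp [iot, Fin.sum_univ_two]
    · linear_combination (t 0 : ℝ) * hddR - (t 0 : ℝ) * d * hdR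
    · linear_combination (t 1 : ℝ) * hddR - (t 1 : ℝ) * d * hdR
    · linear_combination (t 0 - l : ℝ) * hddR - (t 0 - l : ℝ) * d * hdR
    · linear_combination (t 1 : ℝ) * hddR - (t 1 : ℝ) * d * hdR
    · linear_combination (t 0 : ℝ) * hddR - (t 0 : ℝ) * d * hdR
    · linear_combination (t 1 - 1 : ℝ) * hddR - (t 1 - 1 : ℝ) * d * hdR

lemma equiv_mpr {P : Set E2} {l : ℕ} {q e w : E2} (hq : q ∈ Lat2) (he : e ∈ Lat2) (hw : w ∈ Lat2)
    (hD : |dt e w| = 1) (hP : P = convexHull ℝ ({q, q + (l : ℝ) • e, q + w} : Set E2)) :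
    ∃ (A : Matrix (Fin 2) (Fin 2) ℤ) (t : Fin 2 → ℤ), IsUnit A.det ∧
      (fun x : Fin 2 → ℝ => fun i => (∑ j, (A i j : ℝ) * x j) + (t i : ℝ)) '' P
            = convexHull ℝ ({![(0 : ℝ), 0], ![(l : ℝ), 0], ![(0 : ℝ), 1]} : Set (Fin 2 → ℝ)) := by
  obtain ⟨⟨q0, q1⟩, rfl⟩ := mem_lat_iff.1 hq
  obtain ⟨⟨e0, e1⟩, rfl⟩ := mem_lat_iff.1 he
  obtain ⟨⟨w0, w1⟩, rfl⟩ := mem_lat_iff.1 hw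
  obtain ⟨d, hd⟩ : ∃ d : ℤ, d = e0 * w1 - e1 * w0 := ⟨_, rfl⟩
  have hdR : (d : ℝ) = e0 * w1 - e1 * w0 := by exact_mod_cast hd
  have hdt : dt (iot (e0, e1)) (iot (w0, w1)) = d := by
    rw [hdR]; simp [dt, iot]
  rw [hdt] at hD
  have hd1 : d = 1 ∨ d = -1 := by
    rcases eq_or_eq_neg_of_abs_eq hD with h | h
    · left; exact_mod_cast h
    · right; exact_mod_cast h
  have hdd : d * d = 1 := by
    rcases hd1 with h | h <;> rw [h] <;> rfl
  have hddR : (d : ℝ) * d = 1 := by exact_mod_cast hdd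
  refine ⟨!![d * w1, - d * w0; - d * e1, d * e0],
    ![- (d * w1 * q0 + - d * w0 * q1), - (- d * e1 * q0 + d * e0 * q1)], ?_, ?_⟩
  · rw [Matrix.det_fin_two, Int.isUnit_iff]
    have : (!![d * w1, - d * w0; - d * e1, d * e0] : Matrix (Fin 2) (Fin 2) ℤ) 0 0 * (!![d * w1, - d * w0; - d * e1, d * e0] : Matrix (Fin 2) (Fin 2) ℤ) 1 1
      - (!![d * w1, - d * w0; - d * e1, d * e0] : Matrix (Fin 2) (Fin 2) ℤ) 0 1 * (!![d * w1, - d * w0; - d * e1, d * e0] : Matrix (Fin 2) (Fin 2) ℤ) 1 0 = d := by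
      simp
      linear_combination (e0 * w1 - e1 * w0) * hdd - hd
    rw [this]; exact hd1
  · rw [hP, affA_tri]
    congr 1
    have E1 : ∀ a b c a' b' c' : E2, a = a' → b = b' → c = c' → ({a, b, c} : Set E2) = {a', b', c'} := by
      rintro a b c _ _ _ rfl rfl rfl; rfl
    apply E1
    all_goals
      ext i
      fin_cases i <;> simp [iot, Fin.sum_univ_two]
    · linear_combination (l : ℝ) * hddR - (l : ℝ) * d * hdR
    · ring
    · ring
    · linear_combination hddR - d * hdR

/-- for a 2-dimensional lattice polytope `P ⊆ ℝ²`, `δ(P) ≥ 0`, with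
equality iff `P` is equivalent under a unimodular affine transformation
`x ↦ Ax + t` (`A ∈ GL₂(ℤ)`, `t ∈ ℤ²`) to `conv((0,0), (l,0), (0,1))` for some `l ≥ 1`;
i.e. the only dual defective normal projective toric surfaces are the cones
`ℙ(1,1,l)`. -/
theorem defective_toric_surfaces (P : Set (Fin 2 → ℝ)) (V : Finset (Fin 2 → ℝ))
    (hV : (V : Set (Fin 2 → ℝ)) ⊆ Lat2) (hP : P = convexHull ℝ (V : Set (Fin 2 → ℝ)))
    (hdim : (interior P).Nonempty) :
    0 ≤ deltaP P ∧
      (deltaP P = 0 ↔ ∃ l : ℕ, 0 < l ∧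
        ∃ (A : Matrix (Fin 2) (Fin 2) ℤ) (t : Fin 2 → ℤ), IsUnit A.det ∧
          (fun x : Fin 2 → ℝ => fun i => (∑ j, (A i j : ℝ) * x j) + (t i : ℝ)) '' P
            = convexHull ℝ ({![(0 : ℝ), 0], ![(l : ℝ), 0], ![(0 : ℝ), 1]} :
                Set (Fin 2 → ℝ))) := by
  have hLP : LP P := by
    refine ⟨?_, ?_, ?_, hdim⟩
    · rw [hP]; exact Set.Finite.isCompact_convexHull ℝ V.finite_toSet
    · rw [hP]; exact convex_convexHull ℝ _
    · conv_lhs => rw [hP]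
      refine convexHull_mono (fun x hx => ⟨?_, hV hx⟩)
      rw [hP]; exact subset_convexHull ℝ _ hx
  by_cases hA : ∀ v ∈ Set.extremePoints ℝ P, (interior (Pv P v)).Nonempty
  · have hpos := caseA hLP hA
    refine ⟨hpos.le, fun h => absurd h hpos.ne', ?_⟩
    rintro ⟨l, hl, A, t, hAd, him⟩
    obtain ⟨q, hq, e, he, w, hw, hD, hPe⟩ := equiv_mp A t hAd him
    rw [hPe]; exact delta_tri hl hq he hw hD
  · push Not at hA
    obtain ⟨v, hv, hB⟩ := hA
    obtain ⟨l, hl, q, hq, e, he, w, hw, hD, hPe⟩ := caseB hLP hv (Set.not_nonempty_iff_eq_empty.2 hB)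
    have h0 : deltaP P = 0 := by rw [hPe]; exact delta_tri hl hq he hw hD
    exact ⟨h0.ge, fun _ => ⟨l, hl, equiv_mpr hq he hw hD hPe⟩, fun _ => h0⟩
end

section
/- For all integers k > m > n ≥ 1 with (m,n) ≠ (2,1), the inequality 4k²m²n² − 3kmn(1+k+m+n) + 2(k+m+n+mn+kn+km) − 1 − k² − m² − n² ≥ 2(k+m+n+mn) + kn + km − 1 > 0 holds. (This is the key estimate in the proof that a weighted projective 3-space ℙ(1,k,m,n) with isolated singularities is not dual defective unless k = m = n = 1: combined with the bounds Eu(v₁) ≤ k², Eu(v₂) ≤ m², Eu(v₃) ≤ n² on the local Euler obstructions at the three possibly singular vertices, it shows the Matsui–Takeuchi degree expression 4Vol(P) − 3A(P) + 2E(P) − Σ_v Eu(v) is strictly positive.) -/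
/-- the key estimate showing that `ℙ(1,k,m,n)` with isolated singularities
is not dual defective unless `k = m = n = 1`: for integers `k > m > n ≥ 1` with
`(m,n) ≠ (2,1)`,
`4k²m²n² − 3kmn(1+k+m+n) + 2(k+m+n+mn+kn+km) − 1 − k² − m² − n²
  ≥ 2(k+m+n+mn) + kn + km − 1 > 0`. -/
theorem wps_threefold_nondefective_estimate (k m n : ℤ)
    (hkm : m < k) (hmn : n < m) (hn : 1 ≤ n) (hexc : ¬ (m = 2 ∧ n = 1)) :
    4 * k ^ 2 * m ^ 2 * n ^ 2 - 3 * k * m * n * (1 + k + m + n)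
          + 2 * (k + m + n + m * n + k * n + k * m) - 1 - k ^ 2 - m ^ 2 - n ^ 2
        ≥ 2 * (k + m + n + m * n) + k * n + k * m - 1 ∧
      2 * (k + m + n + m * n) + k * n + k * m - 1 > 0 := by
  have hm : 3 ≤ m := by
    by_contra h
    exact hexc ⟨by omega, by omega⟩
  have hk : 4 ≤ k := by omega
  have hmn0 : 0 < m * n := by positivity
  have hkn0 : 0 < k * n := by positivity
  have hkm0 : 0 < k * m := by positivity
  constructor
  · have h1 : 0 ≤ n * (k - n) := mul_nonneg (by omega) (by omega)
    have h2 : 0 ≤ m * (k - m) := mul_nonneg (by omega) (by omega)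
    have hp : 3 ≤ m * n := by nlinarith
    have hs : 0 ≤ (m - 1) * (n - 1) := mul_nonneg (by omega) (by omega)
    have hs2 : m + n ≤ m * n + 1 := by linarith
    have key : 0 ≤ 4 * k * (m * n) ^ 2 - 3 * (m * n) * (1 + k + m + n) - k := by
      generalize m * n = p at *
      have a : 0 ≤ p * (p + 1 - (m + n)) := mul_nonneg (by omega) (by omega)
      have b : 0 ≤ (k - 4) * (4 * p ^ 2 - 3 * p - 1) :=
        mul_nonneg (by omega) (by nlinarith)
      nlinarith
    have key2 := mul_nonneg (by omega : 0 ≤ k) key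
    nlinarith
  · linarith
end
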